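/- Let K be a number field, not isomorphic to the 12th cyclotomic field ℚ(ζ₁₂), such that condition cond_A(K) or condition cond_B(K) holds and such that E₀(K) = E₀(ℚ). Let L be a quadratic extension of K and let (t, X₁, X₃) be a non-trivial point of the curve 𝒞 over L. Then t lies in the image of ℚ in L, and moreover X₁ lies in the image of ℚ or X₃ lies in the image of ℚ. -/

import Mathlib

noncomputable section

/-- `x` lies in the image of `ℚ`. -/
def inQ {L : Type*} [DivisionRing L] [CharZero L] (x : L) : Prop :=
  ∃ q : ℚ, (q : L) = x

/-- `cond_A(K)`: every `K`-point of `E₁`, `E₁⁻¹`, `E₄`, `E₆`, `E₆⁻¹` is rational. -/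
def condA (K : Type*) [Field K] [CharZero K] : Prop :=
  (∀ x y : K, y ^ 2 = x ^ 3 - x ^ 2 + x → inQ x ∧ inQ y) ∧
  (∀ x y : K, y ^ 2 = x ^ 3 + x ^ 2 + x → inQ x ∧ inQ y) ∧
  (∀ x y : K, y ^ 2 = x ^ 3 - x ^ 2 - 64 * x + 220 → inQ x ∧ inQ y) ∧
  (∀ x y : K, y ^ 2 = x ^ 3 - x ^ 2 - 4 * x + 4 → inQ x ∧ inQ y) ∧
  (∀ x y : K, y ^ 2 = x ^ 3 + x ^ 2 - 4 * x - 4 → inQ x ∧ inQ y)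

/-- `cond_B(K)`: `E₁(K)` and `E₁⁻¹(K)` are finite (rank `0`), and `[K:ℚ] < 8` or `[K:ℚ]` odd. -/
def condB (K : Type*) [Field K] [CharZero K] : Prop :=
  {p : K × K | p.2 ^ 2 = p.1 ^ 3 - p.1 ^ 2 + p.1}.Finite ∧
  {p : K × K | p.2 ^ 2 = p.1 ^ 3 + p.1 ^ 2 + p.1}.Finite ∧
  (Module.finrank ℚ K < 8 ∨ Odd (Module.finrank ℚ K))

/-- `(t, X₁, X₃)` is a point of the genus-5 curve `𝒞`: `X₁² = G(t)` and `X₃² = G(-t)`,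
where `G(x) = x⁴ - 2x³ + 2x² + 2x + 1`. -/
def CPt {L : Type*} [Field L] (t X₁ X₃ : L) : Prop :=
  X₁ ^ 2 = t ^ 4 - 2 * t ^ 3 + 2 * t ^ 2 + 2 * t + 1 ∧
  X₃ ^ 2 = t ^ 4 + 2 * t ^ 3 + 2 * t ^ 2 - 2 * t + 1

/-- The point `(t, X₁, X₃)` of `𝒞` is non-trivial. -/
def CNontrivial {L : Type*} [Field L] (t X₁ X₃ : L) : Prop :=
  t ≠ 0 ∧ t ≠ 1 ∧ t ≠ -1 ∧ X₁ ≠ 0 ∧ X₃ ≠ 0 ∧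
  t ^ 2 + 1 ≠ 0 ∧ t ^ 2 - 2 * t - 1 ≠ 0 ∧ t ^ 2 + 2 * t - 1 ≠ 0

/-- `t` belongs to the set `𝒯` of roots of `(x⁴ + x³ + 2x² - x + 1)(x⁴ - x³ + 2x² + x + 1)`. -/
def inT {L : Type*} [Field L] (t : L) : Prop :=
  (t ^ 4 + t ^ 3 + 2 * t ^ 2 - t + 1) * (t ^ 4 - t ^ 3 + 2 * t ^ 2 + t + 1) = 0


theorem zz_pyth (x y z : ℤ) (hx : x % 2 = 1) (hc : IsCoprime x y) (h : x^2 + 4*y^2 = z^2) :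
    ∃ e f : ℤ, x = e^2 - f^2 ∧ y = e*f ∧ |z| = e^2 + f^2 ∧ IsCoprime e f ∧ 2 ∣ y := by
  have hz : z ≠ 0 := by
    rintro rfl
    have : x = 0 := by nlinarith [sq_nonneg x, sq_nonneg y]
    omega
  have h1 : PythagoreanTriple x (2*y) |z| := by
    unfold PythagoreanTriple
    have := abs_mul_abs_self z
    nlinarith
  have h2 : Int.gcd x (2*y) = 1 := by
    rw [← Int.isCoprime_iff_gcd_eq_one]
    refine IsCoprime.mul_right ?_ hc
    exact ⟨1, -(x/2), by omega⟩
  obtain ⟨m, n, a1, a2, a3, a4, a5, a6⟩ := h1.coprime_classification' h2 hx (abs_pos.mpr hz)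
  refine ⟨m, n, a1, by linarith, a3, Int.isCoprime_iff_gcd_eq_one.mpr a4, ?_⟩
  have : y = m*n := by linarith
  rw [this]
  rcases a5 with ⟨h, _⟩ | ⟨_, h⟩
  · exact Dvd.dvd.mul_right (Int.dvd_of_emod_eq_zero h) _
  · exact Dvd.dvd.mul_left (Int.dvd_of_emod_eq_zero h) _

theorem zz_four (a b m n : ℤ) (h : a*b = m*n) (ha : a ≠ 0) :
    ∃ r s t u : ℤ, a = r*s ∧ m = r*t ∧ b = t*u ∧ n = s*u ∧ IsCoprime s t := by
  have hg : 0 < Int.gcd a m := Int.gcd_pos_of_ne_zero_left _ ha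
  obtain ⟨s, t, h1, h2, h3⟩ := Int.exists_gcd_one hg
  set r : ℤ := (Int.gcd a m : ℤ) with hr
  have hr0 : r ≠ 0 := by omega
  have hst : IsCoprime s t := Int.isCoprime_iff_gcd_eq_one.mpr h1
  have h4 : s * b = t * n := by
    apply mul_left_cancel₀ hr0
    calc r * (s*b) = (s*r)*b := by ring
      _ = (t*r)*n := by rw [← h2, ← h3, h]
      _ = _ := by ring
  have h5 : s ∣ n := hst.dvd_of_dvd_mul_left ⟨b, h4.symm⟩
  obtain ⟨u, hu⟩ := h5
  have hs0 : s ≠ 0 := by rintro rfl; simp at h2; exact ha h2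
  refine ⟨r, s, t, u, by rw [h2]; ring, by rw [h3]; ring, ?_, hu, hst⟩
  apply mul_left_cancel₀ hs0
  rw [h4, hu]; ring

/-- `k` divides 3 -/
theorem zz_k3 (k s t A B : ℤ) (hc : IsCoprime s t) (h1 : 3*s^2 = k*A) (h2 : 3*t^2 = k*B) :
    k = 1 ∨ k = -1 ∨ k = 3 ∨ k = -3 := by
  obtain ⟨x, y, hxy⟩ := (hc.pow_left (m := 2)).pow_right (n := 2)
  have : k ∣ 3 := ⟨x*A + y*B, by linear_combination (-3)*hxy + x*h1 + y*h2⟩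
  have h3 : k ≤ 3 := Int.le_of_dvd (by norm_num) this
  have h4 : -k ≤ 3 := Int.le_of_dvd (by norm_num) ((neg_dvd).mpr this)
  have : k = -3 ∨ k = -2 ∨ k = -1 ∨ k = 0 ∨ k = 1 ∨ k = 2 ∨ k = 3 := by omega
  rcases this with rfl|rfl|rfl|rfl|rfl|rfl|rfl <;> norm_num at * 

theorem zz_sq_mod (t : ℤ) (ht : t % 2 = 1) : t^2 % 4 = 1 := by
  obtain ⟨c, hc⟩ : ∃ c, t = 2*c+1 := ⟨t/2, by omega⟩
  subst hc
  have : (2*c+1)^2 = 4*(c^2+c)+1 := by ring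
  omega

theorem zz_lt (r s t u : ℤ) (hr : r ≠ 0) (hs : s ≠ 0) (ht : t ≠ 0) (hu : u ≠ 0) :
    r.natAbs < (2*(r*s)*(t*u)).natAbs ∧ s.natAbs < (2*(r*s)*(t*u)).natAbs := by
  simp only [Int.natAbs_mul]
  have hr := Int.natAbs_pos.mpr hr
  have hs := Int.natAbs_pos.mpr hs
  have ht := Int.natAbs_pos.mpr ht
  have hu := Int.natAbs_pos.mpr hu
  generalize r.natAbs = r at *
  generalize s.natAbs = s at *
  generalize t.natAbs = t at *
  generalize u.natAbs = u at *
  have h1 : 1 ≤ t*u := Nat.mul_pos ht hu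
  have h2 : r ≤ r*s := Nat.le_mul_of_pos_right _ hs
  have h3 : s ≤ r*s := Nat.le_mul_of_pos_left _ hr
  have h4 : 2*(r*s) ≤ 2*(r*s)*(t*u) := Nat.le_mul_of_pos_right _ h1
  simp only [show Int.natAbs 2 = 2 from rfl]
  omega

theorem zz_odd_mul {t u : ℤ} (h : (t*u) % 2 = 1) : t % 2 = 1 ∧ u % 2 = 1 := by
  rw [Int.mul_emod] at h
  rcases Int.emod_two_eq_zero_or_one t with a | a <;> rcases Int.emod_two_eq_zero_or_one u with b | b <;>
    simp_all

theorem zz_coprime_odd {a b : ℤ} (h : IsCoprime a b) (ha : a % 2 = 0) : b % 2 = 1 := by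
  obtain ⟨x, y, e⟩ := h
  by_contra hb
  have hb : b % 2 = 0 := by omega
  have h1 : (2:ℤ) ∣ x*a := Dvd.dvd.mul_left (by omega) _
  have h2 : (2:ℤ) ∣ y*b := Dvd.dvd.mul_left (by omega) _
  omega

theorem zz_Dminus : ∀ N : ℕ, ∀ a b m n : ℤ, (a*b).natAbs = N → IsCoprime a b → IsCoprime m n →
    a*b = 2*(m*n) → a^2 - b^2 = m^2 - n^2 → a*b = 0 := by
  intro N
  induction N using Nat.strong_induction_on with
  | _ N ih =>
  have key : ∀ a b m n : ℤ, a % 2 = 0 → (a*b).natAbs = N → IsCoprime a b → IsCoprime m n →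
    a*b = 2*(m*n) → a^2 - b^2 = m^2 - n^2 → a*b = 0 := by
    intro a b m n hae hN hab hmn h1 h2
    by_contra h0
    have hb := zz_coprime_odd hab hae
    obtain ⟨a', rfl⟩ : ∃ c, a = 2*c := ⟨a/2, by omega⟩
    have ha0 : a' ≠ 0 := by rintro rfl; simp at h0
    obtain ⟨r, s, t, u, rfl, rfl, rfl, rfl, hst⟩ := zz_four a' b m n (by linarith) ha0
    obtain ⟨ht, hu⟩ := zz_odd_mul hb
    have hr0 : r ≠ 0 := by rintro rfl; simp at h0
    have hs0 : s ≠ 0 := by rintro rfl; simp at h0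
    have ht0 : t ≠ 0 := by rintro rfl; simp at h0
    have hu0 : u ≠ 0 := by rintro rfl; simp at h0
    have hru : IsCoprime r u :=
      (hab.of_isCoprime_of_dvd_left ⟨2*s, by ring⟩).of_isCoprime_of_dvd_right ⟨t, by ring⟩
    have e1 : r^2*(4*s^2-t^2) = u^2*(t^2-s^2) := by linear_combination h2
    have hru2 : IsCoprime (u^2) (r^2) := hru.symm.pow
    obtain ⟨k, hk⟩ : u^2 ∣ (4*s^2-t^2) := hru2.dvd_of_dvd_mul_left ⟨_, e1⟩
    have hk2 : t^2 - s^2 = k*r^2 := by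
      apply mul_left_cancel₀ (pow_ne_zero 2 hu0)
      rw [← e1, hk]; ring
    have m1 := zz_sq_mod t ht
    have m2 := zz_sq_mod u hu
    rcases zz_k3 k s t (u^2+r^2) (u^2+4*r^2) hst (by linear_combination hk + hk2)
      (by linear_combination hk + 4*hk2) with rfl | rfl | rfl | rfl
    · omega
    · have : 0 < u^2 := by positivity
      nlinarith [sq_nonneg r, sq_nonneg s, sq_nonneg t]
    · have f1 : s^2 = u^2 + r^2 := by linarith
      have f2 : t^2 = u^2 + 4*r^2 := by linarith
      obtain ⟨e, f, g1, g2, g3, g4, g5⟩ := zz_pyth u r t hu hru.symm f2.symm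
      obtain ⟨r', rfl⟩ := g5
      obtain ⟨g, h, k1, k2, k3, k4, k5⟩ := zz_pyth u r' s hu
        (hru.symm.of_isCoprime_of_dvd_right ⟨2, by ring⟩) (by linarith)
      have hlt := (zz_lt (2*r') s t u hr0 hs0 ht0 hu0).1
      have := ih (2*r').natAbs (by rw [← hN]; convert hlt using 2) e f g h (by rw [g2]) g4 k4
        (by rw [← g2, k2]) (by linarith)
      apply hr0; rw [g2, this]
    · omega
  intro a b m n hN hab hmn h1 h2
  rcases Int.emod_two_eq_zero_or_one a with ha | ha
  · exact key a b m n ha hN hab hmn h1 h2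
  · rcases Int.emod_two_eq_zero_or_one b with hb | hb
    · rw [mul_comm]
      exact key b a n m hb (by rw [mul_comm]; exact hN) hab.symm hmn.symm (by linarith) (by linarith)
    · exfalso
      have : (a*b) % 2 = 1 := by rw [Int.mul_emod, ha, hb]; rfl
      omega

theorem zz_Dplus : ∀ N : ℕ, ∀ a b m n : ℤ, (a*b).natAbs = N → IsCoprime a b → IsCoprime m n →
    a*b = 2*(m*n) → a^2 + b^2 = m^2 + n^2 → a*b = 0 := by
  intro N
  induction N using Nat.strong_induction_on with
  | _ N ih =>
  have key : ∀ a b m n : ℤ, a % 2 = 0 → (a*b).natAbs = N → IsCoprime a b → IsCoprime m n →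
    a*b = 2*(m*n) → a^2 + b^2 = m^2 + n^2 → a*b = 0 := by
    intro a b m n hae hN hab hmn h1 h2
    by_contra h0
    have hb := zz_coprime_odd hab hae
    obtain ⟨a', rfl⟩ : ∃ c, a = 2*c := ⟨a/2, by omega⟩
    have ha0 : a' ≠ 0 := by rintro rfl; simp at h0
    obtain ⟨r, s, t, u, rfl, rfl, rfl, rfl, hst⟩ := zz_four a' b m n (by linarith) ha0
    obtain ⟨ht, hu⟩ := zz_odd_mul hb
    have hr0 : r ≠ 0 := by rintro rfl; simp at h0
    have hs0 : s ≠ 0 := by rintro rfl; simp at h0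
    have ht0 : t ≠ 0 := by rintro rfl; simp at h0
    have hu0 : u ≠ 0 := by rintro rfl; simp at h0
    have hru : IsCoprime r u :=
      (hab.of_isCoprime_of_dvd_left ⟨2*s, by ring⟩).of_isCoprime_of_dvd_right ⟨t, by ring⟩
    have e1 : r^2*(4*s^2-t^2) = u^2*(s^2-t^2) := by linear_combination h2
    have hru2 : IsCoprime (u^2) (r^2) := hru.symm.pow
    obtain ⟨k, hk⟩ : u^2 ∣ (4*s^2-t^2) := hru2.dvd_of_dvd_mul_left ⟨_, e1⟩
    have hk2 : s^2 - t^2 = k*r^2 := by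
      apply mul_left_cancel₀ (pow_ne_zero 2 hu0)
      rw [← e1, hk]; ring
    have m1 := zz_sq_mod t ht
    have m2 := zz_sq_mod u hu
    rcases zz_k3 k s t (u^2-r^2) (u^2-4*r^2) hst (by linear_combination hk - hk2)
      (by linear_combination hk - 4*hk2) with rfl | rfl | rfl | rfl
    · omega
    · have f1 : u^2 + 4*s^2 = t^2 := by linarith
      have f2 : r^2 + s^2 = t^2 := by linarith
      have c1 : IsCoprime u s := by
        have : IsCoprime (u^2) s := by
          have := (IsCoprime.pow_left (m := 2) hst.symm)
          rw [← f1] at this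
          have h3 := this.add_mul_left_left (-4*s)
          rwa [show u^2 + 4*s^2 + s*(-4*s) = u^2 by ring] at h3
        exact (IsCoprime.pow_left_iff (by norm_num)).mp this
      have c2 : IsCoprime r s := by
        have : IsCoprime (r^2) s := by
          have := (IsCoprime.pow_left (m := 2) hst.symm)
          rw [← f2] at this
          have h3 := this.add_mul_left_left (-s)
          rwa [show r^2 + s^2 + s*(-s) = r^2 by ring] at h3
        exact (IsCoprime.pow_left_iff (by norm_num)).mp this
      obtain ⟨e, f, g1, g2, g3, g4, g5⟩ := zz_pyth u s t hu c1 f1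
      obtain ⟨r', rfl⟩ := g5
      obtain ⟨g, h, k1, k2, k3, k4, k5⟩ := zz_pyth r r' t (zz_coprime_odd c2.symm (by omega))
        (c2.of_isCoprime_of_dvd_right ⟨2, by ring⟩) (by linarith)
      have hlt := (zz_lt r (2*r') t u hr0 hs0 ht0 hu0).2
      have := ih (2*r').natAbs (by rw [← hN]; convert hlt using 2) e f g h (by rw [g2]) g4 k4
        (by rw [← g2, k2]) (by linarith)
      apply hs0; rw [g2, this]
    · have f1 : t^2 + 4*r^2 = u^2 := by linarith
      have f2 : s^2 + r^2 = u^2 := by linarith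
      have c1 : IsCoprime t r := by
        have : IsCoprime (t^2) r := by
          have := (IsCoprime.pow_left (m := 2) hru.symm)
          rw [← f1] at this
          have h3 := this.add_mul_left_left (-4*r)
          rwa [show t^2 + 4*r^2 + r*(-4*r) = t^2 by ring] at h3
        exact (IsCoprime.pow_left_iff (by norm_num)).mp this
      have c2 : IsCoprime s r := by
        have : IsCoprime (s^2) r := by
          have := (IsCoprime.pow_left (m := 2) hru.symm)
          rw [← f2] at this
          have h3 := this.add_mul_left_left (-r)
          rwa [show s^2 + r^2 + r*(-r) = s^2 by ring] at h3
        exact (IsCoprime.pow_left_iff (by norm_num)).mp this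
      obtain ⟨e, f, g1, g2, g3, g4, g5⟩ := zz_pyth t r u ht c1 f1
      obtain ⟨r', rfl⟩ := g5
      obtain ⟨g, h, k1, k2, k3, k4, k5⟩ := zz_pyth s r' u (zz_coprime_odd c2.symm (by omega))
        (c2.of_isCoprime_of_dvd_right ⟨2, by ring⟩) (by linarith)
      have hlt := (zz_lt (2*r') s t u hr0 hs0 ht0 hu0).1
      have := ih (2*r').natAbs (by rw [← hN]; convert hlt using 2) e f g h (by rw [g2]) g4 k4
        (by rw [← g2, k2]) (by linarith)
      apply hr0; rw [g2, this]
    · omega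
  intro a b m n hN hab hmn h1 h2
  rcases Int.emod_two_eq_zero_or_one a with ha | ha
  · exact key a b m n ha hN hab hmn h1 h2
  · rcases Int.emod_two_eq_zero_or_one b with hb | hb
    · rw [mul_comm]
      exact key b a n m hb (by rw [mul_comm]; exact hN) hab.symm hmn.symm (by linarith) (by linarith)
    · exfalso
      have : (a*b) % 2 = 1 := by rw [Int.mul_emod, ha, hb]; rfl
      omega

theorem zz_Q6e (a b c : ℤ) (hab : IsCoprime a b) (he : 2 ∣ a*b)
    (h : a^4 - a^2*b^2 + b^4 = c^2) : a*b = 0 := by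
  obtain ⟨y, hy⟩ := he
  have ho : (a^2-b^2) % 2 = 1 := by
    rcases Int.emod_two_eq_zero_or_one a with ha | ha
    · have hb := zz_coprime_odd hab ha
      obtain ⟨p, rfl⟩ : ∃ p, a = 2*p := ⟨a/2, by omega⟩
      obtain ⟨q, rfl⟩ : ∃ q, b = 2*q+1 := ⟨b/2, by omega⟩
      ring_nf; omega
    · rcases Int.emod_two_eq_zero_or_one b with hb | hb
      · obtain ⟨p, rfl⟩ : ∃ p, a = 2*p+1 := ⟨a/2, by omega⟩
        obtain ⟨q, rfl⟩ : ∃ q, b = 2*q := ⟨b/2, by omega⟩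
        ring_nf; omega
      · exfalso
        have : (a*b) % 2 = 1 := by rw [Int.mul_emod, ha, hb]; rfl
        omega
  have c1 : IsCoprime (a^2-b^2) (a*b) := by
    refine IsCoprime.mul_right ?_ ?_
    · have h3 := ((hab.symm.pow_left (m := 2)).neg_left).add_mul_left_left a
      rwa [show -b^2 + a*a = a^2-b^2 by ring] at h3
    · have h3 := (hab.pow_left (m := 2)).add_mul_left_left (-b)
      rwa [show a^2 + b*(-b) = a^2-b^2 by ring] at h3
  obtain ⟨e, f, g1, g2, g3, g4, g5⟩ := zz_pyth (a^2-b^2) y c ho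
    (c1.of_isCoprime_of_dvd_right ⟨2, by rw [hy]; ring⟩)
    (by rw [← h]; linear_combination (-(a*b)-2*y)*hy)
  exact zz_Dminus _ a b e f rfl hab g4 (by rw [hy, g2]) g1

theorem zz_Q6 (a b c : ℤ) (hab : IsCoprime a b)
    (h : a^4 - a^2*b^2 + b^4 = c^2) : a*b = 0 ∨ a^2 = b^2 := by
  rcases Int.emod_two_eq_zero_or_one (a*b) with he | ho
  · exact Or.inl (zz_Q6e a b c hab (Int.dvd_of_emod_eq_zero he) h)
  · right
    obtain ⟨ha, hb⟩ := zz_odd_mul ho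
    have ha := zz_sq_mod a ha
    have hb := zz_sq_mod b hb
    obtain ⟨Y, hY⟩ : ∃ Y, a^2 - b^2 = 2*Y := ⟨(a^2-b^2)/2, by omega⟩
    obtain ⟨Z, hZ⟩ : ∃ Z, a^2 + b^2 = 2*Z := ⟨(a^2+b^2)/2, by omega⟩
    have c1 : IsCoprime (a*b) (a^2-b^2) := by
      refine IsCoprime.mul_left ?_ ?_
      · have h3 := ((hab.symm.pow_left (m := 2)).neg_left).add_mul_left_left a
        rw [show -b^2 + a*a = a^2-b^2 by ring] at h3
        exact h3.symm
      · have h3 := (hab.pow_left (m := 2)).add_mul_left_left (-b)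
        rw [show a^2 + b*(-b) = a^2-b^2 by ring] at h3
        exact h3.symm
    obtain ⟨e, f, g1, g2, g3, g4, g5⟩ := zz_pyth (a*b) Y c ho
      (c1.of_isCoprime_of_dvd_right ⟨2, by rw [hY]; ring⟩)
      (by rw [← h]; linear_combination (-(a^2-b^2)-2*Y)*hY)
    have : e*f = 0 := zz_Q6e e f Z g4 (by rw [← g2]; exact g5) (by
      have h4 : 4*Z^2 = 4*(a*b)^2 + 4*Y^2 := by
        linear_combination (-(a^2+b^2)-2*Z)*hZ + ((a^2-b^2)+2*Y)*hY
      rw [g1, g2] at h4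
      linarith)
    rw [this] at g2
    linarith

theorem zz_Q6' (a b c : ℤ) (hab : IsCoprime a b)
    (h : a^4 + a^2*b^2 + b^4 = c^2) : a*b = 0 := by
  have hcc : IsCoprime c (a*b) := by
    have : IsCoprime (c^2) (a*b) := by
      rw [← h]
      refine IsCoprime.mul_right ?_ ?_
      · have h3 := (hab.symm.pow_left (m := 4)).add_mul_left_left (a^3+a*b^2)
        rwa [show b^4 + a*(a^3+a*b^2) = a^4 + a^2*b^2 + b^4 by ring] at h3
      · have h3 := (hab.pow_left (m := 4)).add_mul_left_left (b^3+b*a^2)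
        rwa [show a^4 + b*(b^3+b*a^2) = a^4 + a^2*b^2 + b^4 by ring] at h3
    exact (IsCoprime.pow_left_iff (by norm_num)).mp this
  rcases Int.emod_two_eq_zero_or_one (a*b) with he | ho
  · have hc := zz_coprime_odd hcc.symm he
    obtain ⟨y, hy⟩ := Int.dvd_of_emod_eq_zero he
    obtain ⟨e, f, g1, g2, g3, g4, g5⟩ := zz_pyth c y (a^2+b^2) hc
      (hcc.of_isCoprime_of_dvd_right ⟨2, by rw [hy]; ring⟩)
      (by rw [← h]; linear_combination (-(a*b)-2*y)*hy)
    rw [abs_of_nonneg (by positivity)] at g3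
    exact zz_Dplus _ a b e f rfl hab g4 (by rw [hy, g2]) g3
  · exfalso
    obtain ⟨ha, hb⟩ := zz_odd_mul ho
    have h1 := zz_sq_mod a ha
    have h2 := zz_sq_mod b hb
    obtain ⟨p, hp⟩ : ∃ p, a^2 = 4*p+1 := ⟨a^2/4, by omega⟩
    obtain ⟨q, hq⟩ : ∃ q, b^2 = 4*q+1 := ⟨b^2/4, by omega⟩
    have h3 : c^2 = 4*(4*p^2+2*p + (4*p*q+p+q) + 4*q^2+2*q) + 3 := by
      rw [← h, show a^4 = (a^2)^2 by ring, show b^4 = (b^2)^2 by ring, hp, hq]; ring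
    rcases Int.emod_two_eq_zero_or_one c with hc | hc
    · obtain ⟨d, rfl⟩ : ∃ d, c = 2*d := ⟨c/2, by omega⟩
      rw [show (2*d)^2 = 4*d^2 by ring] at h3
      omega
    · have := zz_sq_mod c hc
      omega

theorem zz_Erat (ε : ℤ) (hε : ε = 1 ∨ ε = -1) (x y : ℚ) (h : y^2 = x^3 + ε*x^2 + x) (hx : x ≠ 0) :
    ∃ a b c : ℤ, IsCoprime a b ∧ a ≠ 0 ∧ b ≠ 0 ∧ x * b^2 = a^2 ∧ a^4 + ε*a^2*b^2 + b^4 = c^2 := by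
  set p : ℤ := x.num with hp
  set q : ℤ := (x.den : ℤ) with hq
  have hq0 : 0 < q := by rw [hq]; exact_mod_cast x.den_pos
  have hq0' : (q:ℚ) ≠ 0 := by exact_mod_cast hq0.ne'
  have hp0 : p ≠ 0 := Rat.num_ne_zero.mpr hx
  have hpq : IsCoprime p q := by
    rw [Int.isCoprime_iff_gcd_eq_one, Int.gcd]
    simpa [hp, hq] using x.reduced
  have hxpq : x * q = p := by
    rw [hp, hq]; exact_mod_cast Rat.mul_den_eq_num x
  have h1 : (y*q^2)^2 = ((p*q*(p^2+ε*(p*q)+q^2) : ℤ) : ℚ) := by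
    push_cast
    rw [← hxpq]
    linear_combination (q:ℚ)^4*h
  have h2 : IsSquare ((p*q*(p^2+ε*(p*q)+q^2) : ℤ) : ℚ) := ⟨y*q^2, by rw [← h1]; ring⟩
  rw [Rat.isSquare_intCast_iff] at h2
  obtain ⟨c, hc⟩ := h2
  set N := p^2+ε*(p*q)+q^2 with hN
  have hNpos : 0 < N := by
    rcases hε with h | h <;> rw [hN, h] <;> nlinarith [sq_nonneg (p+q), sq_nonneg (p-q), sq_nonneg p, mul_pos hq0 hq0]
  have cpN : IsCoprime p N := by
    have h3 := (hpq.symm.pow_left (m := 2)).add_mul_left_left (p+ε*q)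
    rw [show q^2 + p*(p+ε*q) = N by rw [hN]; ring] at h3
    exact h3.symm
  have cqN : IsCoprime q N := by
    have h3 := (hpq.pow_left (m := 2)).add_mul_left_left (q+ε*p)
    rw [show p^2 + q*(q+ε*p) = N by rw [hN]; ring] at h3
    exact h3.symm
  have hpp : 0 < p := by
    have : 0 ≤ p*(q*N) := by rw [← mul_assoc, hc]; exact mul_self_nonneg c
    have h5 : 0 < q*N := mul_pos hq0 hNpos
    have h6 := nonneg_of_mul_nonneg_left this h5
    omega
  have sq' : ∀ a b d : ℤ, 0 < a → IsCoprime a b → a*b = d^2 → ∃ e, a = e^2 := by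
    intro a b d ha hab h
    obtain ⟨e, he | he⟩ := Int.sq_of_isCoprime hab h
    · exact ⟨e, he⟩
    · nlinarith [sq_nonneg e]
  obtain ⟨a, ha⟩ := sq' p (q*N) c hpp (hpq.mul_right cpN) (by rw [← mul_assoc, hc]; ring)
  obtain ⟨b, hb⟩ := sq' q (p*N) c hq0 (hpq.symm.mul_right cqN) (by rw [pow_two, ← hc]; ring)
  obtain ⟨d, hd⟩ := sq' N (p*q) c hNpos (cpN.symm.mul_right cqN.symm) (by rw [pow_two, ← hc]; ring)
  refine ⟨a, b, d, ?_, ?_, ?_, ?_, ?_⟩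
  · rw [ha, hb] at hpq
    exact (IsCoprime.pow_iff (by norm_num) (by norm_num)).mp hpq
  · rintro rfl; apply hp0; rw [ha]; rfl
  · rintro rfl; rw [hb] at hq0; simp at hq0
  · rw [ha, hb] at hxpq; exact_mod_cast hxpq
  · rw [← hd, hN, ha, hb]; ring

theorem zz_E1Q (x y : ℚ) (h : y^2 = x^3 - x^2 + x) : x = 0 ∨ x = 1 := by
  by_cases hx : x = 0
  · exact Or.inl hx
  right
  obtain ⟨a, b, c, h1, h2, h3, h4, h5⟩ := zz_Erat (-1) (Or.inr rfl) x y (by rw [h]; push_cast; ring) hx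
  rcases zz_Q6 a b c h1 (by rw [← h5]; ring) with h6 | h6
  · rcases mul_eq_zero.mp h6 with h | h <;> contradiction
  · have h7 : (a:ℚ)^2 = b^2 := by exact_mod_cast h6
    rw [h7] at h4
    have h8 : (b:ℚ)^2 ≠ 0 := pow_ne_zero 2 (by exact_mod_cast h3)
    exact mul_right_cancel₀ h8 (by rw [h4, one_mul])

theorem zz_E1tQ (x y : ℚ) (h : y^2 = x^3 + x^2 + x) : x = 0 := by
  by_contra hx
  obtain ⟨a, b, c, h1, h2, h3, h4, h5⟩ := zz_Erat 1 (Or.inl rfl) x y (by rw [h]; push_cast; ring) hx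
  rcases mul_eq_zero.mp (zz_Q6' a b c h1 (by rw [← h5]; ring)) with h | h <;> contradiction

open scoped NumberField in
theorem zz_val (K : Type*) [Field K] [NumberField K]
    (h : Module.finrank ℚ K < 8 ∨ Odd (Module.finrank ℚ K)) :
    ∃ (v : K → ℤ) (e : ℤ), 0 < e ∧ ¬ (8 ∣ e) ∧ v 2 = e ∧
      (∀ x y, x ≠ 0 → y ≠ 0 → v (x*y) = v x + v y) ∧
      (∀ x y, x ≠ 0 → y ≠ 0 → x + y ≠ 0 → min (v x) (v y) ≤ v (x+y)) := by
  classical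
  set p : Ideal ℤ := Ideal.span {2} with hp
  have hp0 : p ≠ ⊥ := by rw [hp]; simp
  have hpm : p.IsMaximal := by
    rw [hp]
    exact PrincipalIdealRing.isMaximal_of_irreducible (Int.prime_two.irreducible)
  have hsum := Ideal.sum_ramification_inertia (R := ℤ) (S := 𝓞 K) ℚ K (p := p) hp0
  have hex : ∃ P ∈ IsDedekindDomain.primesOverFinset p (𝓞 K), ¬ 8 ∣ Ideal.ramificationIdx' p P := by
    by_contra! hall
    have : 8 ∣ Module.finrank ℚ K := by
      rw [← hsum]
      exact Finset.dvd_sum fun P hP => Dvd.dvd.mul_right (hall P hP) _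
    have hpos : 0 < Module.finrank ℚ K := Module.finrank_pos
    rcases h with h | h
    · exact absurd (Nat.le_of_dvd hpos this) (by omega)
    · rw [Nat.odd_iff] at h; omega
  obtain ⟨P, hP, hP8⟩ := hex
  rw [IsDedekindDomain.mem_primesOverFinset_iff hp0] at hP
  obtain ⟨hP1, hP2⟩ := hP
  have hPbot : P ≠ ⊥ := Ideal.ne_bot_of_liesOver_of_ne_bot hp0 P
  have hmap : Ideal.map (algebraMap ℤ (𝓞 K)) p = Ideal.span {(2 : 𝓞 K)} := by
    rw [hp, Ideal.map_span]; simp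
  have hmap0 : Ideal.map (algebraMap ℤ (𝓞 K)) p ≠ ⊥ := by
    rw [hmap]; simp
  have hram0 : Ideal.ramificationIdx' p P ≠ 0 :=
    Ideal.IsDedekindDomain.ramificationIdx'_ne_zero_of_liesOver _ hp0
  have hmult := Ideal.IsDedekindDomain.ramificationIdx'_eq_multiplicity hmap0 hP1
  rw [hmap] at hmult
  let V : IsDedekindDomain.HeightOneSpectrum (𝓞 K) := ⟨P, hP1, hPbot⟩
  have hne : ∀ x : K, x ≠ 0 → V.valuation K x ≠ 0 := fun x hx => by
    rwa [Ne, Valuation.zero_iff]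
  refine ⟨fun x => -(WithZero.log (V.valuation K x)), (Ideal.ramificationIdx' p P : ℤ), by omega, by omega, ?_, ?_, ?_⟩
  · have h2 : V.valuation K (2:K) = V.intValuation (2 : 𝓞 K) := by
      rw [show (2:K) = algebraMap (𝓞 K) K 2 from (map_ofNat _ 2).symm, V.valuation_of_algebraMap]
    show -(WithZero.log (V.valuation K 2)) = _
    rw [h2, V.intValuation_eq_exp_neg_multiplicity (by norm_num), WithZero.log_exp, hmult]
    simp [V]
  · intro x y hx hy
    show -(WithZero.log (V.valuation K (x*y))) = _
    rw [map_mul, WithZero.log_mul (hne x hx) (hne y hy)]; ring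
  · intro x y hx hy hxy
    have := (V.valuation K).map_add x y
    show _ ≤ -(WithZero.log (V.valuation K (x+y)))
    rcases le_max_iff.mp this with h | h
    · have := (WithZero.log_le_log (hne _ hxy) (hne x hx)).mpr h
      exact (min_le_left _ _).trans (by linarith)
    · have := (WithZero.log_le_log (hne _ hxy) (hne y hy)).mpr h
      exact (min_le_right _ _).trans (by linarith)

structure ZZVal (K : Type*) [Field K] where
  v : K → ℤ
  e : ℤ
  pos : 0 < e
  h8 : ¬ (8 ∣ e)
  two_ne : (2:K) ≠ 0
  two : v 2 = e
  mul : ∀ x y, x ≠ 0 → y ≠ 0 → v (x*y) = v x + v y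
  add : ∀ x y, x ≠ 0 → y ≠ 0 → x + y ≠ 0 → min (v x) (v y) ≤ v (x+y)

namespace ZZVal
variable {K : Type*} [Field K] (V : ZZVal K)

def G (n : ℤ) (x : K) : Prop := x = 0 ∨ n ≤ V.v x
def E (n : ℤ) (x : K) : Prop := x ≠ 0 ∧ V.v x = n

variable {V}
theorem v_one : V.v 1 = 0 := by
  have := V.mul 1 1 one_ne_zero one_ne_zero
  rw [mul_one] at this; omega
theorem v_neg_one : V.v (-1) = 0 := by
  have := V.mul (-1) (-1) (neg_ne_zero.mpr one_ne_zero) (neg_ne_zero.mpr one_ne_zero)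
  rw [neg_one_mul, neg_neg, v_one] at this; omega
theorem v_neg (x : K) : V.v (-x) = V.v x := by
  by_cases hx : x = 0
  · rw [hx, neg_zero]
  · have := V.mul (-1) x (neg_ne_zero.mpr one_ne_zero) hx
    rw [neg_one_mul, v_neg_one] at this; omega

theorem E.cast {m n : ℤ} {x y : K} (h : V.E m x) (h1 : m = n) (h2 : x = y) : V.E n y := by
  subst h1 h2; exact h
theorem G.cast {m n : ℤ} {x y : K} (h : V.G m x) (h1 : n ≤ m) (h2 : x = y) : V.G n y := by
  subst h2
  rcases h with h | h
  · exact Or.inl h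
  · exact Or.inr (h1.trans h)
theorem E.G {n : ℤ} {x : K} (h : V.E n x) : V.G n x := Or.inr h.2.ge
theorem E.ne {n : ℤ} {x : K} (h : V.E n x) : x ≠ 0 := h.1
theorem E.uniq {m n : ℤ} {x : K} (h : V.E m x) (h' : V.E n x) : m = n := by
  rw [← h.2, h'.2]
theorem E.neg {n : ℤ} {x : K} (h : V.E n x) : V.E n (-x) :=
  ⟨neg_ne_zero.mpr h.1, by rw [v_neg]; exact h.2⟩
theorem G.neg {n : ℤ} {x : K} (h : V.G n x) : V.G n (-x) := by
  rcases h with h | h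
  · left; rw [h, neg_zero]
  · right; rwa [v_neg]
theorem E.mul {m n : ℤ} {x y : K} (h : V.E m x) (h' : V.E n y) : V.E (m+n) (x*y) :=
  ⟨mul_ne_zero h.1 h'.1, by rw [V.mul _ _ h.1 h'.1, h.2, h'.2]⟩
theorem G.mul {m n : ℤ} {x y : K} (h : V.G m x) (h' : V.G n y) : V.G (m+n) (x*y) := by
  by_cases hx : x = 0
  · left; rw [hx, zero_mul]
  by_cases hy : y = 0
  · left; rw [hy, mul_zero]
  right
  rw [V.mul _ _ hx hy]
  have h := h.resolve_left hx
  have h' := h'.resolve_left hy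
  omega
theorem G.add {n : ℤ} {x y : K} (h : V.G n x) (h' : V.G n y) : V.G n (x+y) := by
  by_cases hx : x = 0
  · rwa [hx, zero_add]
  by_cases hy : y = 0
  · rwa [hy, add_zero]
  by_cases hxy : x + y = 0
  · exact Or.inl hxy
  right
  have h := h.resolve_left hx
  have h' := h'.resolve_left hy
  have := V.add x y hx hy hxy
  exact (le_min h h').trans this
theorem G.sub {n : ℤ} {x y : K} (h : V.G n x) (h' : V.G n y) : V.G n (x-y) := by
  rw [sub_eq_add_neg]; exact h.add h'.neg
theorem E.not_G {m n : ℤ} {x : K} (h : V.E m x) (h' : V.G n x) : n ≤ m := by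
  rw [← h.2]; exact h'.resolve_left h.1
theorem E.add {m n : ℤ} {x y : K} (h : V.E m x) (h' : V.G n y) (hmn : m < n) : V.E m (x+y) := by
  have h0 : x + y ≠ 0 := by
    intro h0
    have : y = -x := by linear_combination h0
    rw [this] at h'
    have := h.neg.not_G h'
    omega
  refine ⟨h0, le_antisymm ?_ ?_⟩
  · by_contra hlt
    push Not at hlt
    have h1 : V.G (m+1) (x+y) := Or.inr hlt
    have h2 : V.G (m+1) x := (h1.sub (h'.cast (n := m+1) (by omega) rfl)).cast le_rfl (by ring)
    have := h.not_G h2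
    omega
  · exact (h.G.add (h'.cast hmn.le rfl)).resolve_left h0
theorem E.div {m n : ℤ} {x y : K} (h : V.E m (x*y)) (h' : V.E n x) : V.E (m-n) y := by
  have hy : y ≠ 0 := right_ne_zero_of_mul h.1
  refine ⟨hy, ?_⟩
  have h1 := h.2
  rw [V.mul _ _ h'.1 hy, h'.2] at h1
  omega
theorem exE {x : K} (h : x ≠ 0) : ∃ n, V.E n x := ⟨V.v x, h, rfl⟩
theorem G.div {m n : ℤ} {x y : K} (h : V.G m (x*y)) (h' : V.E n x) : V.G (m-n) y := by
  by_cases hy : y = 0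
  · exact Or.inl hy
  obtain ⟨j, hj⟩ := exE (V := V) hy
  have := (h'.mul hj).not_G h
  exact hj.G.cast (by omega) rfl
theorem E.half {m : ℤ} {x : K} (h : V.E m (x^2)) : ∃ j, 2*j = m ∧ V.E j x := by
  have hx : x ≠ 0 := by rintro rfl; exact h.1 (by simp)
  obtain ⟨j, hj⟩ := exE (V := V) hx
  exact ⟨j, by have := h.uniq ((hj.mul hj).cast rfl (by ring)); omega, hj⟩
theorem E2 : V.E V.e (2:K) := ⟨V.two_ne, V.two⟩
theorem E1 : V.E 0 (1:K) := ⟨one_ne_zero, v_one⟩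
theorem G1 : V.G 0 (1:K) := E1.G
theorem G2 : V.G V.e (2:K) := E2.G
theorem E3 : V.E 0 (3:K) := (E1.add G2 V.pos).cast rfl (by norm_num)
theorem lemS {m d : ℤ} {A B : K} (h : V.E m (A*B)) (hd : V.G d (A-B)) (hm : m < 2*d) :
    ∃ j, 2*j = m ∧ V.E j A ∧ V.E j B := by
  obtain ⟨i, hi⟩ := exE (V := V) (left_ne_zero_of_mul h.1)
  obtain ⟨j, hj⟩ := exE (V := V) (right_ne_zero_of_mul h.1)
  have h1 := h.uniq (hi.mul hj)
  rcases lt_or_ge i d with h2 | h2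
  · have := (hi.add hd.neg h2).cast rfl (show A + -(A-B) = B by ring)
    have h3 := hj.uniq this
    subst h3
    exact ⟨j, by omega, hi, hj⟩
  · rcases lt_or_ge j d with h4 | h4
    · have := (hj.add hd h4).cast rfl (show B + (A-B) = A by ring)
      have h3 := hi.uniq this
      subst h3
      exact ⟨i, by omega, hi, hj⟩
    · omega
theorem lemS2 {j : ℤ} {A B : K} (h : V.G (2*j) (A*B)) (hd : V.G j (A-B)) : V.G j A := by
  by_cases hA : A = 0
  · exact Or.inl hA
  obtain ⟨i, hi⟩ := exE (V := V) hA
  by_contra hc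
  have : i < j := by
    by_contra h'
    exact hc (hi.G.cast (by omega) rfl)
  have hB := (hi.add hd.neg this).cast rfl (show A + -(A-B) = B by ring)
  have := (hi.mul hB).not_G h
  omega

theorem common (a : K) (ha : V.G 0 a) (ha2 : V.E 0 (a+2)) (Z : Set (K × K)) (hfin : Z.Finite)
    (hZ : ∀ p ∈ Z, p.1 ≠ 0 ∧ p.2 ≠ 0 ∧ p.2^2 = p.1^4 + a*p.1^2 + 1 ∧
      ∃ q ∈ Z, 2*p.1*p.2*q.1 = p.1^4 - 1) :
    ∀ p ∈ Z, ∃ k, V.e = 4*k ∧ V.E 0 p.1 ∧ V.E 0 p.2 ∧ V.E k (p.1-1) ∧ V.E k (p.1+1) ∧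
      V.E (2*k) (p.1^2-1) ∧ V.E (4*k) (p.1^4-1) := by
  have hV := V.pos
  have step1 : ∀ p ∈ Z, 0 ≤ V.v p.1 := by
    intro p0 hp0
    obtain ⟨p, hp, hmin⟩ := Set.exists_min_image Z (fun p => V.v p.1) hfin ⟨p0, hp0⟩
    refine le_trans ?_ (hmin p0 hp0)
    by_contra hneg
    push Not at hneg
    obtain ⟨h1, h2, h3, q, hq, h4⟩ := hZ p hp
    obtain ⟨h5, -, -, -⟩ := hZ q hq
    set n := V.v p.1 with hn
    have e1 : V.E n p.1 := ⟨h1, rfl⟩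
    have e2 : V.E (n+n) (p.1^2) := (e1.mul e1).cast rfl (by ring)
    have e4 : V.E (n+n+(n+n)) (p.1^4) := (e2.mul e2).cast rfl (by ring)
    have e5 : V.E (n+n+(n+n)) (p.1^4-1) :=
      (e4.add G1.neg (by omega)).cast rfl (by ring)
    have e6 : V.E (n+n+(n+n)) (p.2^2) := by
      refine (e4.add (n := n+n) ((ha.mul e2.G).cast (n := n+n) (by omega) rfl |>.add (G1.cast (by omega) rfl)) (by omega)).cast rfl ?_
      rw [h3]; ring
    obtain ⟨w, hw, e7⟩ := e6.half
    have e8 := (e5.cast rfl h4.symm).div ((E2.mul e1).mul e7)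
    have := hmin q hq
    change V.v p.1 ≤ V.v q.1 at this
    rw [e8.2] at this
    omega
  have step2 : ∀ p ∈ Z, V.E 0 p.1 := by
    intro p hp
    refine ⟨(hZ p hp).1, le_antisymm ?_ (step1 p hp)⟩
    by_contra hpos
    push Not at hpos
    obtain ⟨h1, h2, h3, q, hq, h4⟩ := hZ p hp
    obtain ⟨h5, -, -, -⟩ := hZ q hq
    set n := V.v p.1 with hn
    have e1 : V.E n p.1 := ⟨h1, rfl⟩
    have e2 : V.E (n+n) (p.1^2) := (e1.mul e1).cast rfl (by ring)
    have e4 : V.E (n+n+(n+n)) (p.1^4) := (e2.mul e2).cast rfl (by ring)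
    have e5 : V.E 0 (p.1^4-1) :=
      (E1.neg.add e4.G (by omega)).cast rfl (by ring)
    have e6 : V.E 0 (p.2^2) := by
      refine (E1.add (n := n+n) (((ha.mul e2.G).cast (n := n+n) (by omega) rfl).add (e4.G.cast (by omega) rfl)) (by omega)).cast rfl ?_
      rw [h3]; ring
    obtain ⟨w, hw, e7⟩ := e6.half
    have e8 := (e5.cast rfl h4.symm).div ((E2.mul e1).mul e7)
    have := step1 q hq
    rw [e8.2] at this
    omega
  intro p hp
  obtain ⟨h1, h2, h3, q, hq, h4⟩ := hZ p hp
  have e1 := step2 p hp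
  have e2 : V.E 0 (p.1^2) := (e1.mul e1).cast rfl (by ring)
  have eq := step2 q hq
  have gW : V.G 0 p.2 := by
    obtain ⟨j, hj⟩ := exE (V := V) h2
    have : V.G 0 (p.2^2) := by
      rw [h3]
      exact ((e2.G.mul e2.G |>.cast le_rfl (show p.1^2*p.1^2 = p.1^4 by ring)).add (ha.mul e2.G)).add G1
    have := (hj.mul hj).cast rfl (show p.2*p.2=p.2^2 by ring) |>.not_G this
    exact hj.G.cast (by omega) rfl
  have g4 : V.G V.e (p.1^4-1) := by
    rw [← h4]
    exact ((G2.mul e1.G).mul gW |>.mul eq.G).cast (by omega) rfl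
  -- v(ρ²-1) > 0
  have g2 : V.G 1 (p.1^2-1) := by
    by_cases h0 : p.1^2-1 = 0
    · exact Or.inl h0
    obtain ⟨i, hi⟩ := exE (V := V) h0
    by_contra hc
    have hi0 : i ≤ 0 := by
      by_contra h'
      exact hc (hi.G.cast (by omega) rfl)
    have g0 : V.G 0 (p.1^2-1) := e2.G.sub G1
    have := hi.not_G g0
    have hi' : V.E 0 (p.1^2+1) := by
      have : i = 0 := by omega
      subst this
      exact (hi.add G2 V.pos).cast rfl (by ring)
    have := ((hi.mul hi').cast rfl (show (p.1^2-1)*(p.1^2+1) = p.1^4-1 by ring)).not_G g4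
    omega
  have eW : V.E 0 p.2 := by
    have : V.E 0 (p.2^2) := by
      refine ((ha2.mul e2).add (n := 1) ((g2.mul g2).cast (by omega) rfl) (by omega)).cast rfl ?_
      rw [h3]; ring
    obtain ⟨j, hj, h⟩ := this.half
    exact h.cast (by omega) rfl
  have e4 : V.E V.e (p.1^4-1) := by
    rw [← h4]
    exact ((E2.mul e1).mul eW |>.mul eq).cast (by omega) rfl
  obtain ⟨j, hj, f1, f2⟩ := lemS (d := V.e) (e4.cast rfl (show _ = (p.1^2-1)*(p.1^2+1) by ring))
    (E2.neg.G.cast le_rfl (by ring)) (by omega)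
  obtain ⟨k, hk, f3, f4⟩ := lemS (d := V.e) (f1.cast rfl (show _ = (p.1-1)*(p.1+1) by ring))
    (E2.neg.G.cast le_rfl (by ring)) (by omega)
  exact ⟨k, by omega, e1, eW, f3, f4, f1.cast (by omega) rfl, e4.cast (by omega) rfl⟩

theorem V1 (V : ZZVal K) (Z : Set (K × K)) (hfin : Z.Finite)
    (hZ : ∀ p ∈ Z, p.1 ≠ 0 ∧ p.2 ≠ 0 ∧ p.2^2 = p.1^4 + (-1)*p.1^2 + 1 ∧
      ∃ q ∈ Z, 2*p.1*p.2*q.1 = p.1^4 - 1) (p : K × K) (hp : p ∈ Z) : False := by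
  have hV := V.pos
  have hcom := common (V := V) (-1) G1.neg (E1.cast rfl (by norm_num)) Z hfin hZ
  obtain ⟨k, hk, e1, eW, f1, f2, f3, f4⟩ := hcom p hp
  obtain ⟨h1, h2, h3, q, hq, h4⟩ := hZ p hp
  obtain ⟨k', hk', q1, -, q2, -⟩ := hcom q hq
  have hkk : k' = k := by omega
  subst hkk
  generalize p.1 = ρ at *
  generalize p.2 = W at *
  generalize q.1 = ρ' at *
  have e2 : V.E 0 (ρ^2) := (e1.mul e1).cast rfl (by ring)
  have ee : V.E (4*k') (2:K) := E2.cast hk rfl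
  -- η
  have d2 : V.E (2*k') ((ρ-1)^2) := (f1.mul f1).cast (by ring) (by ring)
  have d3 : V.E (3*k') ((ρ-1)^3) := (f1.mul d2).cast (by ring) (by ring)
  have u0 : V.E 0 (ρ^2-ρ+1) := ((E1.add (f1.mul e1).G (by omega))).cast rfl (by ring)
  have n1 : V.E (6*k') ((W-(ρ^2-ρ+1))*(W+(ρ^2-ρ+1))) := by
    refine ((ee.mul e1).mul d2).cast (by ring) ?_
    linear_combination -h3
  obtain ⟨j, hj, n2, -⟩ := lemS (d := 4*k') n1 ((ee.G.mul u0.neg.G).cast (by omega) (by ring)) (by omega)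
  have hj' : j = 3*k' := by omega
  subst hj'
  set η := W-(ρ^2-ρ+1) with hη
  set δ := ρ - 1 with hδ
  have g5 : V.G (3*k') (1-ρ*W) := by
    have s1 : V.E (2*k') (ρ^2+1) := (f3.add ee.G (by omega)).cast rfl (by ring)
    refine (((f1.mul s1).G.cast (n := 3*k') (by omega) rfl).add ((e1.mul n2).G.cast (n := 3*k') (by omega) rfl)).neg.cast le_rfl ?_
    rw [hη, hδ]; ring
  have e5 : V.E k' (1-ρ*W*ρ') :=
    (q2.neg.add (n := 3*k') ((q1.G.mul g5).cast (by omega) rfl) (by omega)).cast rfl (by ring)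
  have e6 : V.E (5*k') (2-δ^4) := by
    have t1 := (ee.mul e5).cast (n := 5*k') (by ring) rfl
    have g4 : V.G (8*k') (4:K) := (ee.G.mul ee.G).cast (by omega) (by norm_num)
    have t2 : V.G (6*k') (4*δ^3 + 6*δ^2 + 4*δ) := by
      refine (((g4.mul d3.G).cast (n := 6*k') (by omega) rfl).add ?_).add ((g4.mul f1.G).cast (n := 6*k') (by omega) rfl)
      exact (((ee.G.mul E3.G).mul d2.G).cast (n := 6*k') (by omega) (by ring))
    refine (t1.add t2 (by omega)).cast rfl ?_
    rw [hδ]; linear_combination (-1)*h4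
  have id1 : (η-δ^3)*(η+δ^3) = δ^2*(2-δ^4) - 2*(η-δ^3) - 2*η*ρ*δ := by
    have : W = η + (ρ^2-ρ+1) := by rw [hη]; ring
    have hr : ρ = δ+1 := by rw [hδ]; ring
    rw [this, hr] at h3
    rw [hr]
    linear_combination h3
  have gA : V.G (3*k') (η-δ^3) := n2.G.sub d3.G
  have rest : V.G (7*k') ((η-δ^3)*(η+δ^3)) := by
    rw [id1]
    refine (((d2.mul e6).G.cast (n := 7*k') (by omega) rfl).sub ((ee.G.mul gA).cast (n := 7*k') (by omega) rfl)).sub ?_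
    exact (((ee.mul n2).mul e1).mul f1).G.cast (by omega) rfl
  have gA' : V.G (3*k'+1) (η-δ^3) := by
    by_cases h0 : η-δ^3 = 0
    · exact Or.inl h0
    obtain ⟨i, hi⟩ := exE (V := V) h0
    have h6 := hi.not_G gA
    by_contra hc
    have h7 : i = 3*k' := by
      by_contra h'
      exact hc (hi.G.cast (by omega) rfl)
    subst h7
    have hB : V.E (3*k') (η+δ^3) := (hi.add (ee.G.mul d3.G) (by omega)).cast rfl (by ring)
    have := (hi.mul hB).not_G rest
    omega
  have e7 : V.E (7*k') ((η-δ^3)*(η+δ^3)) := by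
    have t1 := (d2.mul e6).cast (n := 7*k') (by ring) rfl
    refine (t1.add (n := 7*k'+1) (((ee.G.mul gA').cast (n := 7*k'+1) (by omega) rfl).add
      ((((ee.mul n2).mul e1).mul f1).G.cast (n := 7*k'+1) (by omega) rfl)).neg (by omega)).cast rfl ?_
    rw [id1]; ring
  obtain ⟨j, hj, -⟩ := lemS (d := 7*k') e7 ((ee.mul d3).neg.G.cast (by omega) (by ring)) (by omega)
  have := V.h8
  omega

theorem V2 (V : ZZVal K) (Z : Set (K × K)) (hfin : Z.Finite)
    (hZ : ∀ p ∈ Z, p.1 ≠ 0 ∧ p.2 ≠ 0 ∧ p.2^2 = p.1^4 + 1*p.1^2 + 1 ∧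
      ∃ q ∈ Z, 2*p.1*p.2*q.1 = p.1^4 - 1) (p : K × K) (hp : p ∈ Z) : False := by
  have hV := V.pos
  have hcom := common (V := V) 1 G1 (E3.cast rfl (by norm_num)) Z hfin hZ
  obtain ⟨k, hk, e1, eW, f1, f2, f3, f4⟩ := hcom p hp
  obtain ⟨h1, h2, h3, q, hq, h4⟩ := hZ p hp
  obtain ⟨k', hk', q1, -, -, q2, -⟩ := hcom q hq
  have hkk : k' = k := by omega
  subst hkk
  generalize p.1 = ρ at *
  generalize p.2 = W at *
  generalize q.1 = ρ' at *
  have ee : V.E (4*k') (2:K) := E2.cast hk rfl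
  have id1 : (W-ρ)*(W+ρ) = ρ^4 - 1 + 2 := by linear_combination h3
  have g1 : V.G (2*k') (W-ρ) := by
    refine lemS2 (B := W+ρ) ?_ ((ee.mul e1).neg.G.cast (by omega) (by ring))
    rw [id1]
    exact (f4.G.add ee.G).cast (by omega) rfl
  have g2 : V.G (2*k') (ρ*W-1) :=
    (((e1.G.mul g1).cast (n := 2*k') (by omega) rfl).add f3.G).cast le_rfl (by ring)
  have e5 : V.E (5*k') ((W-ρ)*(W+ρ)) := by
    rw [id1]
    have := q2.add (n := 2*k') ((q1.G.mul g2).cast (by omega) rfl) (by omega)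
    refine (ee.mul this).cast (by ring) ?_
    linear_combination h4
  obtain ⟨j, hj, -⟩ := lemS (d := 4*k') e5 ((ee.mul e1).neg.G.cast (by omega) (by ring)) (by omega)
  have := V.h8
  omega

theorem V3 (V : ZZVal K) (s b h : K) (hs : s^2 = 3) (hb : b^2 = 2*s) (hh : h^2 = 1 + s) : False := by
  have hV := V.pos
  have es : V.E 0 s := by
    obtain ⟨j, hj, h⟩ := (E3.cast rfl hs.symm).half
    exact h.cast (by omega) rfl
  have p1 : V.E V.e ((s-1)*(s+1)) := E2.cast rfl (by linear_combination -hs)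
  obtain ⟨j, hj, s1, s2⟩ := lemS (d := V.e) p1 (E2.neg.G.cast le_rfl (by ring)) (by omega)
  obtain ⟨k, hk, eh⟩ := (s2.cast rfl (show s+1 = h^2 by rw [hh]; ring)).half
  have ee : V.E (4*k) (2:K) := E2.cast (by omega) rfl
  have s1 : V.E (2*k) (s-1) := s1.cast (by omega) rfl
  have s2 : V.E (2*k) (s+1) := s2.cast (by omega) rfl
  have h2 := V.two_ne
  obtain ⟨θ, hθ⟩ : ∃ θ : K, 2*θ = b*(s-1) := ⟨b*(s-1)/2, by field_simp⟩
  have hθ2 : θ^2 = 2*s-3 := by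
    have h4 : (4:K) ≠ 0 := by
      have : (4:K) = 2*2 := by norm_num
      rw [this]; exact mul_ne_zero h2 h2
    apply mul_left_cancel₀ h4
    linear_combination (2*θ+b*(s-1))*hθ + (s-1)^2*hb + (2*s-4)*hs
  have p2 : V.E (6*k) ((θ-s)*(θ+s)) :=
    ((ee.mul es).mul s1).neg.cast (by ring) (by linear_combination -hθ2 - hs)
  obtain ⟨j2, hj2, t1, -⟩ := lemS (d := 4*k) p2 ((ee.mul es).neg.G.cast (by omega) (by ring)) (by omega)
  have h3 : V.E (3*k) (h^3) := ((eh.mul eh).mul eh).cast (by ring) (by ring)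
  have p3 : V.E (7*k) ((θ-s-h^3)*(θ-s+h^3)) := by
    have g1 : V.G (4*k) (2*(4+s)) := by
      have g4 : V.G 0 (4:K) := (ee.G.mul ee.G).cast (by omega) (by norm_num)
      exact (ee.G.mul (g4.add es.G)).cast (by omega) rfl
    have := (es.mul t1).add (n := 4*k) g1 (by omega)
    refine (ee.mul this).neg.cast (by omega) ?_
    have h6 : h^6 = (1+s)^3 := by rw [← hh]; ring
    linear_combination -hθ2 + h6 + (s+4)*hs
  obtain ⟨j3, hj3, -⟩ := lemS (d := 7*k) p3 ((ee.mul h3).neg.G.cast (by omega) (by ring)) (by omega)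
  have := V.h8
  omega
end ZZVal


section zzfield
variable {K : Type*} [Field K] [CharZero K]

/-- the three exclusions coming from `E₀` -/
structure ZZEx (K : Type*) [Field K] : Prop where
  n2 : ∀ r : K, r^2 ≠ 2
  nm2 : ∀ r : K, r^2 ≠ -2
  i3 : ∀ i s : K, i^2 = -1 → s^2 = 3 → False

theorem zz_inQ_sq_ne (r : K) (h : inQ r) (n : ℤ) (hn : ∀ q : ℚ, q^2 ≠ n) : r^2 ≠ n := by
  obtain ⟨q, rfl⟩ := h
  intro h'
  exact hn q (by exact_mod_cast h')

theorem zz_q2 (q : ℚ) : q^2 ≠ 2 := by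
  intro h
  have : IsSquare ((2:ℤ) : ℚ) := ⟨q, by rw [← sq, h]; norm_num⟩
  rw [Rat.isSquare_intCast_iff] at this
  obtain ⟨r, hr⟩ := this
  have h1 : r < 2 := by nlinarith
  have h2 : -2 < r := by nlinarith
  interval_cases r <;> omega

theorem zz_q3 (q : ℚ) : q^2 ≠ 3 := by
  intro h
  have : IsSquare ((3:ℤ) : ℚ) := ⟨q, by rw [← sq, h]; norm_num⟩
  rw [Rat.isSquare_intCast_iff] at this
  obtain ⟨r, hr⟩ := this
  have h1 : r < 2 := by nlinarith
  have h2 : -2 < r := by nlinarith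
  interval_cases r <;> omega

theorem zz_inQ_lin {x : K} (a b : ℚ) (ha : a ≠ 0) (h : inQ ((a:K)*x + b)) : inQ x := by
  obtain ⟨q, hq⟩ := h
  refine ⟨(q - b)/a, ?_⟩
  have : (a:K) ≠ 0 := by exact_mod_cast ha
  push_cast
  rw [hq]
  field_simp
  ring

theorem zz_Ex (hE0 : ∀ x y : K, y ^ 2 = x ^ 3 - x ^ 2 - 9 * x + 9 → inQ x ∧ inQ y) : ZZEx K := by
  refine ⟨?_, ?_, ?_⟩
  · intro r hr
    have h := (hE0 (9+6*r) (24*r+36) (by linear_combination (-216*r-360)*hr)).1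
    obtain ⟨q, rfl⟩ := zz_inQ_lin (x := r) 6 9 (by norm_num) (by convert h using 1; push_cast; ring)
    exact zz_q2 q (by exact_mod_cast hr)
  · intro r hr
    have h := (hE0 (1+2*r) (4-4*r) (by linear_combination (-8*r+8)*hr)).1
    obtain ⟨q, rfl⟩ := zz_inQ_lin (x := r) 2 1 (by norm_num) (by convert h using 1; push_cast; ring)
    have : q^2 = -2 := by exact_mod_cast hr
    nlinarith [sq_nonneg q]
  · intro i s hi hs
    obtain ⟨⟨q, hq⟩, -⟩ := hE0 (-s+3*i+i*s) ((i+i*s)*(i*s+s)*(s+i)) (by grind)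
    obtain ⟨⟨q', hq'⟩, -⟩ := hE0 (-s-3*i-i*s) ((-i-i*s)*(-i*s+s)*(s-i)) (by grind)
    have h1 : (((q+q')/(-2) : ℚ) : K) = s := by push_cast; rw [hq, hq']; ring
    rw [← h1] at hs
    exact zz_q3 _ (by exact_mod_cast hs)

theorem zz_dbl (a ρ W : K) (hρ : ρ ≠ 0) (hW : W ≠ 0) (h : W^2 = ρ^4 + a*ρ^2 + 1) :
    ∃ ρ' W' : K, 2*ρ*W*ρ' = ρ^4-1 ∧
      4*ρ^2*W^2*W' = ρ^8+2*a*ρ^6+6*ρ^4+2*a*ρ^2+1 ∧ W'^2 = ρ'^4 + a*ρ'^2 + 1 := by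
  refine ⟨(ρ^4-1)/(2*ρ*W), (ρ^8+2*a*ρ^6+6*ρ^4+2*a*ρ^2+1)/(4*ρ^2*W^2), by field_simp, by field_simp, ?_⟩
  set ρ' := (ρ^4-1)/(2*ρ*W) with h1
  set W' := (ρ^8+2*a*ρ^6+6*ρ^4+2*a*ρ^2+1)/(4*ρ^2*W^2) with h2
  have e1 : (2*ρ*W)*ρ' = ρ^4-1 := by rw [h1]; field_simp
  have e2 : (2*ρ*W)^2*W' = ρ^8+2*a*ρ^6+6*ρ^4+2*a*ρ^2+1 := by rw [h2]; field_simp; ring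
  have hD2 : (2*ρ*W)^2 = 4*ρ^2*(ρ^4 + a*ρ^2 + 1) := by rw [← h]; ring
  have hD : (2*ρ*W)^4 ≠ 0 := pow_ne_zero 4 (by simp [hρ, hW])
  apply mul_left_cancel₀ hD
  have l : (2*ρ*W)^4 * W'^2 = (ρ^8+2*a*ρ^6+6*ρ^4+2*a*ρ^2+1)^2 := by rw [← e2]; ring
  have r : (2*ρ*W)^4 * (ρ'^4 + a*ρ'^2 + 1) = ((2*ρ*W)*ρ')^4 + a*((2*ρ*W)*ρ')^2*(2*ρ*W)^2 + ((2*ρ*W)^2)^2 := by ring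
  rw [l, r, e1, hD2]
  ring

theorem zz_fin (a : K) (S : Set (K × K)) (hfin : S.Finite)
    (hS : ∀ ρ W : K, W^2 = ρ^4 + a*ρ^2 + 1 → (ρ^2, ρ*W) ∈ S) (Z : Set (K × K))
    (hZ : ∀ p ∈ Z, p.1 ≠ 0 ∧ p.2^2 = p.1^4 + a*p.1^2 + 1) : Z.Finite := by
  refine Set.Finite.of_finite_fibers (f := fun p : K × K => (p.1^2, p.1*p.2)) ?_ ?_
  · refine hfin.subset ?_
    rintro _ ⟨p, hp, rfl⟩
    exact hS _ _ (hZ p hp).2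
  · rintro _ ⟨p, hp, rfl⟩
    refine Set.Finite.subset (Set.toFinite {p, (-p.1, -p.2)}) ?_
    rintro ⟨q1, q2⟩ ⟨hq, hq2⟩
    have h0 := (hZ p hp).1
    simp only [Set.mem_preimage, Set.mem_singleton_iff, Prod.mk.injEq] at hq2
    obtain ⟨h1, h2⟩ := hq2
    rcases sq_eq_sq_iff_eq_or_eq_neg.mp h1 with h | h
    · left
      rw [h] at h2
      have := mul_left_cancel₀ h0 h2
      ext <;> assumption
    · right
      rw [h] at h2
      have : q2 = -p.2 := mul_left_cancel₀ h0 (by linear_combination -h2)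
      simp only [Set.mem_singleton_iff, Prod.mk.injEq]
      exact ⟨h, this⟩

theorem zz_sq_cases {x y : K} (h : x^4 = 1) : x^2 = 1 ∨ x^2 = -1 := by
  have : (x^2-1)*(x^2+1) = 0 := by linear_combination h
  rcases mul_eq_zero.mp this with h | h
  · left; linear_combination h
  · right; linear_combination h

theorem zz_W0 (hx : ZZEx K) (ρ : K) (h : ρ^4 - ρ^2 + 1 = 0) : False :=
  hx.i3 (ρ^3) ((2*ρ^2-1)*ρ^3) (by linear_combination (ρ^2+1)*h) (by grind)

theorem zz_N1B (hx : ZZEx K) (V : ZZVal K)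
    (hfin : {p : K × K | p.2 ^ 2 = p.1 ^ 3 - p.1 ^ 2 + p.1}.Finite)
    (ρ W : K) (h : W^2 = ρ^4 - ρ^2 + 1) : ρ = 0 ∨ ρ = 1 ∨ ρ = -1 := by
  by_contra hcon
  push Not at hcon
  obtain ⟨c0, c1, c2⟩ := hcon
  let Z : Set (K × K) := {p | p.2^2 = p.1^4 + (-1)*p.1^2 + 1 ∧ p.1 ≠ 0 ∧ p.1^4 ≠ 1 ∧ p.2 ≠ 0}
  have Zfin : Z.Finite := zz_fin (-1) _ hfin (fun ρ W h => by
    show (ρ*W)^2 = _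
    linear_combination ρ^2*h) Z (fun p hp => ⟨hp.2.1, hp.1⟩)
  refine ZZVal.V1 V Z Zfin ?_ (ρ, W) ?_
  · rintro ⟨ρ, W⟩ ⟨h1, h2, h3, h4⟩
    simp only at h1 h2 h3 h4 ⊢
    refine ⟨h2, h4, h1, ?_⟩
    obtain ⟨ρ', W', d1, d2, d3⟩ := zz_dbl (-1) ρ W h2 h4 h1
    refine ⟨(ρ', W'), ⟨d3, ?_, ?_, ?_⟩, d1⟩
    · rintro rfl
      exact h3 (by linear_combination -d1)
    · intro hc
      simp only at hc
      have d4 : 4*ρ^2*(ρ^4-ρ^2+1)*ρ'^2 = (ρ^4-1)^2 := by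
        rw [← d1]; linear_combination (-4*ρ^2*ρ'^2)*h1
      have hm : ρ*ρ⁻¹ = 1 := mul_inv_cancel₀ h2
      rcases zz_sq_cases (y := ρ) hc with h5 | h5
      · rw [h5] at d4
        have : (ρ^4+1)*(ρ^4-4*ρ^2+1) = 0 := by linear_combination -d4
        rcases mul_eq_zero.mp this with h6 | h6
        · exact hx.n2 (ρ+ρ⁻¹) (by grind)
        · exact hx.n2 (ρ-ρ⁻¹) (by grind)
      · rw [h5] at d4
        have hp : (ρ^2+ρ⁻¹^2)^2 + 4*(ρ^2+ρ⁻¹^2) - 8 = 0 := by grind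
        exact hx.i3 ρ' ((ρ^2+ρ⁻¹^2+2)/2) h5 (by linear_combination hp/4)
    · rintro hc
      simp only at hc
      rw [hc] at d3
      exact zz_W0 hx ρ' (by linear_combination -d3)
  · refine ⟨by simp only; rw [h]; ring, c0, ?_, ?_⟩
    · intro hc
      simp only at hc
      rcases zz_sq_cases (y := ρ) hc with h5 | h5
      · rcases sq_eq_one_iff.mp h5 with h | h
        · exact c1 h
        · exact c2 h
      · exact hx.i3 ρ W h5 (by linear_combination h + (ρ^2-2)*h5)
    · intro hc
      simp only at hc
      rw [hc] at h
      exact zz_W0 hx ρ (by linear_combination -h)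

/-- no `V3` data -/
def ZZNoV3 (K : Type*) [Field K] : Prop :=
  ∀ s b h : K, s^2 = 3 → b^2 = 2*s → h^2 = 1+s → False

theorem zz_beta1 (hn : ZZNoV3 K) (s b g : K) (hs : s^2 = 3) (hb : b^2 = 2*s)
    (hg : 2*g^2 = (1+s)*(1+s+b)*(2+b)) : False := by
  have h1 : 1+s+s*b ≠ 0 := by
    intro h
    have h2 : s = 1 := by
      have : 4*(s - 1) = 0 := by linear_combination (s*b-(1+s))*h - s^2*hb + (1-2*s)*hs
      rcases mul_eq_zero.mp this with h | h
      · norm_num at h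
      · linear_combination h
    rw [h2] at hs; norm_num at hs
  refine hn s b (2*g/(1+s+s*b)) hs hb ?_
  rw [div_pow, div_eq_iff (pow_ne_zero 2 h1)]
  grind

theorem zz_beta2 (hn : ZZNoV3 K) (s b g : K) (hs : s^2 = 3) (hb : b^2 = 2*s)
    (hg : 2*g^2 = (1+s)*(1+s+b)*(2-b)) : False := by
  have h1 : 1-s+b ≠ 0 := by
    intro h
    have h2 : s = 1 := by
      have : 4*(s - 1) = 0 := by linear_combination (b-(1-s))*h - hb + hs
      rcases mul_eq_zero.mp this with h | h
      · norm_num at h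
      · linear_combination h
    rw [h2] at hs; norm_num at hs
  refine hn s b (2*g/(1-s+b)) hs hb ?_
  rw [div_pow, div_eq_iff (pow_ne_zero 2 h1)]
  grind

theorem zz_beta (hn : ZZNoV3 K) (ρ W g : K) (hρ : ρ ≠ 0) (hW : W^2 = ρ^4+ρ^2+1)
    (ho : ρ^8-4*ρ^6-6*ρ^4-4*ρ^2+1 = 0) (hg : 2*(W+ρ^2+1) = g^2) : False := by
  obtain ⟨m, hm⟩ : ∃ m, ρ*m = 1 := ⟨ρ⁻¹, mul_inv_cancel₀ hρ⟩
  have hp : (ρ^2+m^2)^2 - 4*(ρ^2+m^2) - 8 = 0 := by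
    have : (ρ^2+m^2)^2 - 4*(ρ^2+m^2) - 8 = m^4*(ρ^8-4*ρ^6-6*ρ^4-4*ρ^2+1) := by grind
    rw [this, ho, mul_zero]
  obtain ⟨s, hs⟩ : ∃ s, 2*s = ρ^2+m^2-2 := ⟨(ρ^2+m^2-2)/2, by ring⟩
  have hs3 : s^2 = 3 := by linear_combination (2*s+(ρ^2+m^2-2))*hs/4 + hp/4
  have hb : (ρ-m)^2 = 2*s := by linear_combination -hs - 2*hm
  have hu : (ρ+m)^2 = (1+s)^2 := by linear_combination -hs + 2*hm - hs3
  have hw : (2*(W*m))^2 = ((ρ-m)*(1+s))^2 := by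
    have : (W*m)^2 = ρ^2+m^2+1 := by grind
    linear_combination 4*this - (1+s)^2*hb -2*s*hs3 - 4*hs3-4*hs
  have hg2 : 2*g^2 = (ρ+m+(ρ-m))*(2*(W*m)+2*(ρ+m)) := by
    rw [← hg]; linear_combination (-4*W-4)*hm
  rcases sq_eq_sq_iff_eq_or_eq_neg.mp hu with hu | hu <;>
  rcases sq_eq_sq_iff_eq_or_eq_neg.mp hw with hw | hw <;> rw [hu, hw] at hg2
  · exact zz_beta1 hn s (ρ-m) g hs3 hb (by rw [hg2]; ring)
  · exact zz_beta2 hn s (ρ-m) g hs3 hb (by rw [hg2]; ring)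
  · exact zz_beta1 hn s (-(ρ-m)) g hs3 (by rw [← hb]; ring) (by rw [hg2]; ring)
  · exact zz_beta2 hn s (-(ρ-m)) g hs3 (by rw [← hb]; ring) (by rw [hg2]; ring)

theorem zz_N2start (c y : K) (h : y^2 = (c^2-1)*(c^2-4)) (hc : c^2 ≠ 1) :
    ∃ ρ W : K, 2*(c^2-1)*ρ = c*y ∧ 4*(c^2-1)*W = c^4-2*c^2+4 ∧ 4*(c^2-1)*ρ^2 = c^2*(c^2-4) ∧
      W^2 = ρ^4+ρ^2+1 ∧ 2*(W+ρ^2+1) = c^2 := by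
  have h0 : c^2-1 ≠ 0 := sub_ne_zero.mpr hc
  obtain ⟨ρ, h1⟩ : ∃ ρ, 2*(c^2-1)*ρ = c*y := ⟨c*y/(2*(c^2-1)), by field_simp⟩
  obtain ⟨W, h2⟩ : ∃ W, 4*(c^2-1)*W = c^4-2*c^2+4 := ⟨(c^4-2*c^2+4)/(4*(c^2-1)), by field_simp⟩
  have h3 : 4*(c^2-1)*ρ^2 = c^2*(c^2-4) := by
    apply mul_left_cancel₀ h0
    linear_combination (2*(c^2-1)*ρ + c*y)*h1 + c^2*h
  have h00 : (4*(c^2-1) : K) ≠ 0 := mul_ne_zero (by norm_num) h0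
  refine ⟨ρ, W, h1, h2, h3, ?_, ?_⟩
  · apply mul_left_cancel₀ (pow_ne_zero 2 h00)
    linear_combination (4*(c^2-1)*W+(c^4-2*c^2+4))*h2 - (4*(c^2-1)*ρ^2 + c^2*(c^2-4) + 4*(c^2-1))*h3
  · apply mul_left_cancel₀ h00
    linear_combination 2*h2+2*h3

theorem zz_N2B (hx : ZZEx K) (V : ZZVal K) (hn : ZZNoV3 K)
    (hfin : {p : K × K | p.2 ^ 2 = p.1 ^ 3 + p.1 ^ 2 + p.1}.Finite)
    (c y : K) (h : y^2 = (c^2-1)*(c^2-4)) : c = 0 ∨ c^2 = 1 ∨ c^2 = 4 ∨ c^4-8*c^2+4 = 0 := by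
  by_contra hcon
  push Not at hcon
  obtain ⟨c0, c1, c2, c3⟩ := hcon
  obtain ⟨ρ, W, s1, s2, s3, s4, s5⟩ := zz_N2start c y h c1
  have hy : y ≠ 0 := by
    rintro rfl
    have : (c^2-1)*(c^2-4) = 0 := by rw [← h]; ring
    rcases mul_eq_zero.mp this with h | h
    · exact c1 (by linear_combination h)
    · exact c2 (by linear_combination h)
  have hρ0 : ρ ≠ 0 := by
    rintro rfl
    rw [mul_zero] at s1
    exact mul_ne_zero c0 hy s1.symm
  let Z : Set (K × K) := {p | p.2^2 = p.1^4 + 1*p.1^2 + 1 ∧ p.1 ≠ 0 ∧ p.1^4 ≠ 1 ∧ p.2 ≠ 0 ∧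
    p.1^8-4*p.1^6-6*p.1^4-4*p.1^2+1 ≠ 0}
  have Zfin : Z.Finite := zz_fin 1 _ hfin (fun ρ W h => by
    show (ρ*W)^2 = _
    linear_combination ρ^2*h) Z (fun p hp => ⟨hp.2.1, hp.1⟩)
  refine ZZVal.V2 V Z Zfin ?_ (ρ, W) ?_
  · clear * - hx hn
    rintro ⟨ρ, W⟩ ⟨h1, h2, h3, h4, h8⟩
    simp only at h1 h2 h3 h4 h8 ⊢
    refine ⟨h2, h4, h1, ?_⟩
    obtain ⟨ρ', W', d1, d2, d3⟩ := zz_dbl 1 ρ W h2 h4 h1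
    obtain ⟨m, hm⟩ : ∃ m, ρ*m = 1 := ⟨ρ⁻¹, mul_inv_cancel₀ h2⟩
    have d4 : 4*ρ^2*(ρ^4+ρ^2+1)*ρ'^2 = (ρ^4-1)^2 := by
      rw [← d1]; linear_combination (-4*ρ^2*ρ'^2)*h1
    have hρ' : ρ' ≠ 0 := by
      rintro rfl
      exact h3 (by linear_combination -d1)
    refine ⟨(ρ', W'), ⟨d3, hρ', ?_, ?_, ?_⟩, d1⟩
    · intro hc
      simp only at hc
      rcases zz_sq_cases (y := ρ) hc with h5 | h5
      · rw [h5] at d4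
        exact h8 (by linear_combination -d4)
      · rw [h5] at d4
        have : (ρ^4+1)*(ρ^4+4*ρ^2+1) = 0 := by linear_combination -d4
        rcases mul_eq_zero.mp this with h6 | h6
        · exact hx.n2 (ρ+m) (by
            have : (ρ+m)^2 - 2 = m^2*(ρ^4+1) := by grind
            rw [h6] at this; linear_combination this)
        · exact hx.i3 ρ' (ρ^2+2) h5 (by linear_combination h6)
    · rintro hc
      simp only at hc
      rw [hc] at d3 d2
      have p1 : (ρ^2+m^2)^2 + 2*(ρ^2+m^2) + 4 = 0 := by
        have : (ρ^2+m^2)^2 + 2*(ρ^2+m^2) + 4 = m^4*(ρ^8+2*1*ρ^6+6*ρ^4+2*1*ρ^2+1) := by clear * - hm; grind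
        rw [this, ← d2]; ring
      have p2 : 4*(ρ^2+m^2+1)*ρ'^2 = (ρ^2+m^2)^2-4 := by
        have a1 : 4*(ρ^2+m^2+1)*ρ'^2 = m^4*(4*ρ^2*(ρ^4+ρ^2+1)*ρ'^2) := by clear * - hm; grind
        have a2 : (ρ^2+m^2)^2-4 = m^4*(ρ^4-1)^2 := by clear * - hm; grind
        rw [a1, a2, d4]
      have p3 : (ρ+m)^2 = ρ^2+m^2+2 := by linear_combination 2*hm
      generalize ρ^2+m^2 = p at p1 p2 p3
      have hp1 : p+1 ≠ 0 := by
        intro h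
        have : (3:K) = 0 := by linear_combination p1 - (p+1)*h
        norm_num at this
      have p4 : 2*ρ'^2 = p := by
        apply mul_left_cancel₀ hp1
        linear_combination p2/2 - p1/2
      refine hx.nm2 ((ρ+m)/ρ'^2) ?_
      rw [div_pow, p3, div_eq_iff (by positivity)]
      linear_combination -p4 - 2*d3
    · intro ho
      simp only at ho
      refine zz_beta hn ρ' W' (ρ+m) hρ' (by rw [d3]; ring) ho ?_
      have hD : 4*ρ^2*W^2 ≠ 0 := by simp [h2, h4]
      apply mul_left_cancel₀ hD
      have e1 : (ρ+m)^2*ρ^2 = (ρ^2+1)^2 := by grind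
      have e2 : 4*ρ^2*W^2*ρ'^2 = (ρ^4-1)^2 := by rw [← d1]; ring
      linear_combination 2*d2 + 2*e2 - 4*W^2*e1 + (8*ρ^2 - 4*(ρ^2+1)^2)*h1
  · refine ⟨by simp only; rw [s4]; ring, hρ0, ?_, ?_, ?_⟩
    · intro hc
      simp only at hc
      rcases zz_sq_cases (y := ρ) hc with h5 | h5
      · rw [h5] at s3
        exact c3 (by linear_combination -s3)
      · rw [h5] at s3
        have : (c^2-2)*(c^2+2) = 0 := by linear_combination -s3
        rcases mul_eq_zero.mp this with h6 | h6
        · exact hx.n2 c (by linear_combination h6)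
        · exact hx.nm2 c (by linear_combination h6)
    · intro hc
      simp only at hc
      rw [hc, mul_zero] at s2
      refine hx.nm2 (4*c/c^4) ?_
      rw [div_pow, div_eq_iff (by positivity)]
      have : c^6 = -8 := by linear_combination -(c^2+2)*s2
      linear_combination 2*c^2*this
    · intro ho
      exact zz_beta hn ρ W c hρ0 s4 ho s5

theorem zz_NA (hA : condA K) :
    (∀ ρ W : K, W^2 = ρ^4 - ρ^2 + 1 → ρ = 0 ∨ ρ = 1 ∨ ρ = -1) ∧
    (∀ c y : K, y^2 = (c^2-1)*(c^2-4) → c = 0 ∨ c^2 = 1 ∨ c^2 = 4 ∨ c^4-8*c^2+4 = 0) ∧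
    ZZNoV3 K := by
  obtain ⟨h1, h2, -⟩ := hA
  have h1' : ∀ x y : K, y^2 = x^3 - x^2 + x → x = 0 ∨ x = 1 := by
    intro x y h
    obtain ⟨⟨q, rfl⟩, ⟨r, rfl⟩⟩ := h1 x y h
    rcases zz_E1Q q r (by exact_mod_cast h) with h | h
    · left; rw [h]; simp
    · right; rw [h]; simp
  have h2' : ∀ x y : K, y^2 = x^3 + x^2 + x → x = 0 := by
    intro x y h
    obtain ⟨⟨q, rfl⟩, ⟨r, rfl⟩⟩ := h2 x y h
    rw [zz_E1tQ q r (by exact_mod_cast h)]; simp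
  refine ⟨?_, ?_, ?_⟩
  · intro ρ W h
    rcases h1' (ρ^2) (ρ*W) (by linear_combination ρ^2*h) with h | h
    · left; exact pow_eq_zero_iff (two_ne_zero) |>.mp h
    · right; exact sq_eq_one_iff.mp h
  · intro c y h
    by_cases hc : c^2 = 1
    · exact Or.inr (Or.inl hc)
    obtain ⟨ρ, W, s1, s2, s3, s4, s5⟩ := zz_N2start c y h hc
    have := h2' (ρ^2) (ρ*W) (by linear_combination ρ^2*s4)
    rw [this, mul_zero] at s3
    rcases mul_eq_zero.mp s3.symm with h | h
    · left; exact pow_eq_zero_iff (two_ne_zero) |>.mp h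
    · right; right; left; linear_combination h
  · intro s b h hs hb hh
    have := h2' 1 s (by rw [hs]; norm_num)
    exact one_ne_zero this

theorem zz_NB [NumberField K] (hx : ZZEx K) (hB : condB K) :
    (∀ ρ W : K, W^2 = ρ^4 - ρ^2 + 1 → ρ = 0 ∨ ρ = 1 ∨ ρ = -1) ∧
    (∀ c y : K, y^2 = (c^2-1)*(c^2-4) → c = 0 ∨ c^2 = 1 ∨ c^2 = 4 ∨ c^4-8*c^2+4 = 0) ∧
    ZZNoV3 K := by
  obtain ⟨h1, h2, h3⟩ := hB
  obtain ⟨v, e, a1, a2, a3, a4, a5⟩ := zz_val K h3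
  let V : ZZVal K := ⟨v, e, a1, a2, two_ne_zero, a3, a4, a5⟩
  have hn : ZZNoV3 K := fun s b h hs hb hh => ZZVal.V3 V s b h hs hb hh
  exact ⟨zz_N1B hx V h1, zz_N2B hx V hn h2, hn⟩
end zzfield


section zzgeom
variable {L : Type*} [Field L] [CharZero L]

/-- the arithmetic input about the fixed field of `σ` -/
structure ZZS (L : Type*) [Field L] [CharZero L] (σ : L →+* L) : Prop where
  inv : ∀ x, σ (σ x) = x
  n1 : ∀ ρ W : L, σ ρ = ρ → σ W = W → W^2 = ρ^4 - ρ^2 + 1 → ρ = 0 ∨ ρ = 1 ∨ ρ = -1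
  n2 : ∀ c y : L, σ c = c → σ y = y → y^2 = (c^2-1)*(c^2-4) →
    c = 0 ∨ c^2 = 1 ∨ c^2 = 4 ∨ c^4-8*c^2+4 = 0
  nv : ∀ s b h : L, σ s = s → σ b = b → σ h = h → s^2 = 3 → b^2 = 2*s → h^2 = 1+s → False
  e0 : ∀ x y : L, σ x = x → σ y = y → y ^ 2 = x ^ 3 - x ^ 2 - 9 * x + 9 → inQ x ∧ inQ y
  i3 : ∀ i s : L, σ i = i → σ s = s → i^2 = -1 → s^2 = 3 → False

variable {σ : L →+* L}

theorem zz_N1t (S : ZZS L σ) (τ y : L) (hτ : σ τ = τ) (hy : σ y = y)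
    (h : y^2 = τ^4+8*τ^3+2*τ^2-8*τ+1) : τ = 0 ∨ τ = 1 ∨ τ = -1 := by
  obtain ⟨z, hz⟩ : ∃ z, z = y - τ^2 - 4*τ := ⟨_, rfl⟩
  have hσz : σ z = z := by rw [hz]; simp [map_ofNat, hτ, hy]
  have e : (14+2*z)*τ^2+8*(1+z)*τ+(z^2-1) = 0 := by rw [hz]; linear_combination h
  obtain ⟨w, hw⟩ : ∃ w, w = (14+2*z)*τ+4*(1+z) := ⟨_, rfl⟩
  have hσw : σ w = w := by rw [hw]; simp [map_ofNat, hτ, hσz]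
  have hw2 : w^2 = -2*(1+z)*(z-5)*(z+3) := by rw [hw]; linear_combination (14+2*z)*e
  by_cases h1 : 1+z = 0
  · have : 12*τ^2 = 0 := by linear_combination e + (-2*τ^2-8*τ-(z-1))*h1
    left
    simpa using this
  obtain ⟨ρ, hρ⟩ : ∃ ρ, -4*(1+z)*ρ = w := ⟨w/(-4*(1+z)), by field_simp⟩
  have hσρ : σ ρ = ρ := by
    apply mul_left_cancel₀ (mul_ne_zero (by norm_num : (-4:L) ≠ 0) h1)
    have := congrArg σ hρ
    simp [map_ofNat, hσz, hσw] at this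
    rw [hρ, ← this]; ring
  have hρ2 : 8*(1+z)*ρ^2 = -(z-5)*(z+3) := by
    apply mul_left_cancel₀ h1
    linear_combination (-4*(1+z)*ρ+w)*hρ/2+hw2/2
  have key := S.n1 ρ ((1-z)/4-ρ^2) hσρ (by simp [map_ofNat, hσρ, hσz]) (by linear_combination hρ2/16)
  rcases key with h0 | h0 | h0
  · have : (z-5)*(z+3) = 0 := by rw [h0] at hρ2; linear_combination hρ2
    rw [h0, mul_zero, hw] at hρ
    rcases mul_eq_zero.mp this with h5 | h5
    · right; right
      linear_combination -hρ/24 + (-2*τ-4)*h5/24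
    · right; left
      linear_combination -hρ/8 + (-2*τ-4)*h5/8
  all_goals
    have hh : (z-1)*(z+7) = 0 := by rw [h0] at hρ2; linear_combination hρ2
    rw [h0, hw] at hρ
    rcases mul_eq_zero.mp hh with h5 | h5
    · have : τ*(τ+1) = 0 := by linear_combination e/16 + (-2*τ^2-8*τ-(z+1))*h5/16
      rcases mul_eq_zero.mp this with h | h
      · left; exact h
      · right; right; linear_combination h
    · right; left
      linear_combination -e/48 + (2*τ^2+8*τ+z-7)*h5/48

theorem zz_fix {x : L} (S : ZZS L σ) (h : σ (x^2) = x^2) : σ x = x ∨ σ x = -x := by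
  rw [map_pow] at h
  exact sq_eq_sq_iff_eq_or_eq_neg.mp h

theorem zz_shift (A p m f g : L) (hA : A ≠ 0) (hp : p*A = f) (hm : m*A = g)
    (h : f*(g-A)*((g+A)^2-f^2+4*g*A)+4*g*A*((g+A)^2-f^2) = 0) :
    p*(m-1)*((m+1)^2-p^2+4*m)+4*m*((m+1)^2-p^2) = 0 := by
  apply mul_left_cancel₀ (pow_ne_zero 4 hA)
  rw [← hp, ← hm] at h
  linear_combination h

theorem zz_F (S : ZZS L σ) (a c d v : L) (hv : v ≠ 0) (ha : a^2 = 1-v) (hc : c^2 = 1+v)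
    (hd : d^2 = 1+2*v) :
    (σ a = a ∧ σ c = c ∧ σ d = -d) ∨ (σ a = -a ∧ σ c = -c ∧ σ d = -d) ∨
    (σ a = -a ∧ σ c = c ∧ σ d = d) ∨ (σ a = a ∧ σ c = -c ∧ σ d = d) ∨
    v + σ v + v * σ v = 0 := by
  have hD : 2-a-c ≠ 0 := by
    intro h
    have h1 : (a-c)^2 = 0 := by linear_combination 2*ha+2*hc + (2+a+c)*h
    have h2 : a = c := sub_eq_zero.mp (pow_eq_zero_iff two_ne_zero |>.mp h1)
    rw [h2] at ha
    have : 2*v = 0 := by linear_combination ha-hc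
    exact hv (by simpa using this)
  obtain ⟨τ, hτ⟩ : ∃ τ, τ*(2-a-c) = c-a := ⟨(c-a)/(2-a-c), by field_simp⟩
  have hl : (τ^2+1)*(2-a-c) = 4 := by
    apply mul_left_cancel₀ hD
    linear_combination (τ*(2-a-c)+(c-a))*hτ + 2*ha+2*hc
  have hl0 : τ^2+1 ≠ 0 := by
    intro h; rw [h, zero_mul] at hl; norm_num at hl
  have ea : (τ^2+1)*a = τ^2-2*τ-1 := by
    apply mul_left_cancel₀ hD
    linear_combination (a-1)*hl + 2*hτ
  have ec : (τ^2+1)*c = τ^2+2*τ-1 := by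
    apply mul_left_cancel₀ hD
    linear_combination (c-1)*hl - 2*hτ
  have ev : (τ^2+1)^2*v = 4*τ*(τ^2-1) := by
    linear_combination (τ^2+1)^2*ha - ((τ^2+1)*a+(τ^2-2*τ-1))*ea
  obtain ⟨y, ed⟩ : ∃ y, (τ^2+1)*d = y := ⟨_, rfl⟩
  have hy : y^2 = τ^4+8*τ^3+2*τ^2-8*τ+1 := by
    rw [← ed]; linear_combination (τ^2+1)^2*hd + 2*ev
  obtain ⟨τ', h1⟩ : ∃ x, σ τ = x := ⟨_, rfl⟩
  obtain ⟨y', h2⟩ : ∃ x, σ y = x := ⟨_, rfl⟩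
  obtain ⟨a', ha'⟩ : ∃ x, σ a = x := ⟨_, rfl⟩
  obtain ⟨c', hc'⟩ : ∃ x, σ c = x := ⟨_, rfl⟩
  obtain ⟨d', hd'⟩ : ∃ x, σ d = x := ⟨_, rfl⟩
  obtain ⟨v', hv'⟩ : ∃ x, σ v = x := ⟨_, rfl⟩
  have h1' : σ τ' = τ := by rw [← h1, S.inv]
  have h2' : σ y' = y := by rw [← h2, S.inv]
  have ea' : (τ'^2+1)*a' = τ'^2-2*τ'-1 := by
    have := congrArg σ ea; simpa [map_ofNat, h1, ha'] using this
  have ec' : (τ'^2+1)*c' = τ'^2+2*τ'-1 := by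
    have := congrArg σ ec; simpa [map_ofNat, h1, hc'] using this
  have ed' : (τ'^2+1)*d' = y' := by
    have := congrArg σ ed; simpa [map_ofNat, h1, hd', h2] using this
  have ev' : (τ'^2+1)^2*v' = 4*τ'*(τ'^2-1) := by
    have := congrArg σ ev; simpa [map_ofNat, h1, hv'] using this
  have hl0' : τ'^2+1 ≠ 0 := by
    have : σ (τ^2+1) ≠ 0 := (map_ne_zero σ).mpr hl0
    simpa [map_ofNat, h1] using this
  have hy' : y'^2 = τ'^4+8*τ'^3+2*τ'^2-8*τ'+1 := by
    have := congrArg σ hy; simpa [map_ofNat, h1, h2] using this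
  have hv0 : ¬ (τ = 0 ∨ τ = 1 ∨ τ = -1) := by
    intro h
    have : (τ^2+1)^2*v = 0 := by
      rw [ev]
      rcases h with h | h | h <;> rw [h] <;> ring
    exact mul_ne_zero (pow_ne_zero 2 hl0) hv this
  rw [ha', hc', hd', hv']
  by_cases hne : τ' = τ
  · left
    rw [hne] at ea' ec' ed' hy'
    refine ⟨mul_left_cancel₀ hl0 (ea'.trans ea.symm), mul_left_cancel₀ hl0 (ec'.trans ec.symm), ?_⟩
    rcases sq_eq_sq_iff_eq_or_eq_neg.mp (hy'.trans hy.symm) with h | h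
    · exact absurd (zz_N1t S τ y (by rw [h1, hne]) (by rw [h2, h]) hy) hv0
    · exact mul_left_cancel₀ hl0 (by rw [ed', h, ← ed]; ring)
  have hsub : τ - τ' ≠ 0 := sub_ne_zero.mpr (Ne.symm hne)
  obtain ⟨α, hα⟩ : ∃ α, α*(τ-τ') = (y-τ^2)-(y'-τ'^2) := ⟨((y-τ^2)-(y'-τ'^2))/(τ-τ'), by field_simp⟩
  have hσα : σ α = α := by
    apply mul_right_cancel₀ hsub
    have := congrArg σ hα
    simp [map_ofNat, h1, h2, h1', h2'] at this
    linear_combination -this - hα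
  obtain ⟨β, hβ⟩ : ∃ β, y = τ^2+α*τ+β := ⟨y-τ^2-α*τ, by ring⟩
  have hβ' : y' = τ'^2+α*τ'+β := by linear_combination hβ + hα
  have hσβ : σ β = β := by
    have := congrArg σ hβ
    simp [map_ofNat, h1, h2, hσα] at this
    linear_combination hβ' - this
  have q1 : (8-2*α)*τ^3+(2-α^2-2*β)*τ^2+(-8-2*α*β)*τ+(1-β^2) = 0 := by
    linear_combination (y+τ^2+α*τ+β)*hβ - hy
  have q2 : (8-2*α)*τ'^3+(2-α^2-2*β)*τ'^2+(-8-2*α*β)*τ'+(1-β^2) = 0 := by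
    linear_combination (y'+τ'^2+α*τ'+β)*hβ' - hy'
  have shift : ∀ A f g : L, A ≠ 0 → (τ+τ')*A = f → (τ*τ')*A = g →
     f*(g-A)*((g+A)^2-f^2+4*g*A)+4*g*A*((g+A)^2-f^2) = 0 → v + v' + v*v' = 0 := by
    intro A f g h1 h2 h3 h4
    have := zz_shift A _ _ f g h1 h2 h3 h4
    apply mul_left_cancel₀ (mul_ne_zero (pow_ne_zero 2 hl0) (pow_ne_zero 2 hl0'))
    linear_combination 4*this + ((τ'^2+1)^2+(τ'^2+1)^2*v')*ev + ((τ^2+1)^2+4*τ*(τ^2-1))*ev'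
  have d1 : (8-2*α)*(τ^2+τ*τ'+τ'^2)+(2-α^2-2*β)*(τ+τ')+(-8-2*α*β) = 0 := by
    apply mul_left_cancel₀ hsub
    linear_combination q1-q2
  by_cases hA : 8-2*α = 0
  · right; right; right; right
    have hα4 : α = 4 := by linear_combination -hA/2
    rw [hα4] at d1 q1
    have hB : -2*(7+β) ≠ 0 := by
      intro h
      have hb : β = -7 := by linear_combination -h/2
      rw [hb] at q1
      have : τ = 1 := by linear_combination q1/48
      exact hv0 (by simp [map_ofNat, this])
    have hp : (τ+τ')*(-2*(7+β)) = 8*(1+β) := by linear_combination d1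
    refine shift _ _ (1-β^2) hB hp ?_ ?_
    · linear_combination τ*hp - q1
    · ring
  · obtain ⟨r, hr⟩ : ∃ r, (8-2*α)*(τ+τ'+r) = α^2+2*β-2 :=
      ⟨(α^2+2*β-2)/(8-2*α)-(τ+τ'), by field_simp; ring⟩
    have hσr : σ r = r := by
      apply mul_left_cancel₀ hA
      have := congrArg σ hr
      simp [map_ofNat, h1, h1', hσα, hσβ] at this
      linear_combination this - hr
    have e2 : -8-2*α*β = (8-2*α)*(τ*τ'+r*(τ+τ')) := by linear_combination d1 - (τ+τ')*hr
    have e3 : 1-β^2 = -(8-2*α)*(τ*τ'*r) := by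
      linear_combination q1 - τ^2*hr - τ*e2
    have hQ : (r^2+α*r+β)^2 = r^4+8*r^3+2*r^2-8*r+1 := by
      linear_combination -r*e2 - e3 - r^2*hr
    rcases zz_N1t S r _ hσr (by simp [map_ofNat, hσr, hσα, hσβ]) hQ with h0 | h0 | h0
    · rw [h0] at hQ hr e2
      have : (β-1)*(β+1) = 0 := by linear_combination hQ
      rcases mul_eq_zero.mp this with h | h
      · have hb : β = 1 := by linear_combination h
        rw [hb] at hr e2
        right; right; right; right
        refine shift (8-2*α) (α^2) (-8-2*α) hA ?_ ?_ ?_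
        · linear_combination hr
        · linear_combination -e2
        · ring
      · have hb : β = -1 := by linear_combination h
        rw [hb] at hr e2 hβ hβ'
        have hm : τ*τ' = -1 := by
          apply mul_left_cancel₀ hA; linear_combination -e2
        have hτ0 : τ ≠ 0 := fun h => hv0 (Or.inl h)
        have hk : τ^2*(τ'^2+1) ≠ 0 := mul_ne_zero (pow_ne_zero 2 hτ0) hl0'
        have hkk : τ^2*(τ'^2+1) = τ^2+1 := by linear_combination (τ*τ'-1)*hm
        right; left
        refine ⟨?_, ?_, ?_⟩ <;> apply mul_left_cancel₀ hk
        · linear_combination τ^2*ea' + ea + a*hkk + (τ*τ'-1-2*τ)*hm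
        · linear_combination τ^2*ec' + ec + c*hkk + (τ*τ'-1+2*τ)*hm
        · linear_combination τ^2*ed' + ed + d*hkk + (τ*τ'-1+α*τ)*hm + τ^2*hβ' + hβ
    · rw [h0] at hQ hr e2
      have : (β-1+α)*(β+3+α) = 0 := by linear_combination hQ
      rcases mul_eq_zero.mp this with h | h
      · have hb : β = 1-α := by linear_combination h
        rw [hb] at hr e2 hβ hβ'
        have hm : (τ-1)*(τ'-1) = 2 := by
          apply mul_left_cancel₀ hA; linear_combination -e2 - 2*hr
        have hτ0 : τ-1 ≠ 0 := by
          intro h; rw [h, zero_mul] at hm; norm_num at hm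
        have hk : (τ-1)^2*(τ'^2+1) ≠ 0 := mul_ne_zero (pow_ne_zero 2 hτ0) hl0'
        obtain ⟨w, hw⟩ : ∃ w, (τ-1)*τ' = w := ⟨_, rfl⟩
        have hw2 : w = τ+1 := by linear_combination hm - hw
        rw [hw2] at hw
        have hkk : (τ-1)^2*(τ'^2+1) = 2*(τ^2+1) := by linear_combination ((τ-1)*τ'+τ+1)*hw
        right; right; left
        refine ⟨?_, ?_, ?_⟩ <;> apply mul_left_cancel₀ hk
        · linear_combination (τ-1)^2*ea' + 2*ea + a*hkk + ((τ-1)*τ'+τ+1-2*(τ-1))*hw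
        · linear_combination (τ-1)^2*ec' - 2*ec - c*hkk + ((τ-1)*τ'+τ+1+2*(τ-1))*hw
        · linear_combination (τ-1)^2*ed' - 2*ed - d*hkk + ((τ-1)*τ'+τ+1+α*(τ-1))*hw + (τ-1)^2*hβ' - 2*hβ
      · have hb : β = -3-α := by linear_combination h
        rw [hb] at hr e2
        right; right; right; right
        refine shift (8-2*α) (α^2-16) (α^2+6*α+8) hA ?_ ?_ ?_
        · linear_combination hr
        · linear_combination -e2 - hr
        · ring
    · rw [h0] at hQ hr e2
      have : (β-1-α)*(β+3-α) = 0 := by linear_combination hQ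
      rcases mul_eq_zero.mp this with h | h
      · have hb : β = 1+α := by linear_combination h
        rw [hb] at hr e2 hβ hβ'
        have hm : (τ+1)*(τ'+1) = 2 := by
          apply mul_left_cancel₀ hA; linear_combination -e2 + 2*hr
        have hτ0 : τ+1 ≠ 0 := by
          intro h; rw [h, zero_mul] at hm; norm_num at hm
        have hk : (τ+1)^2*(τ'^2+1) ≠ 0 := mul_ne_zero (pow_ne_zero 2 hτ0) hl0'
        have hw : (τ+1)*τ' = 1-τ := by linear_combination hm
        have hkk : (τ+1)^2*(τ'^2+1) = 2*(τ^2+1) := by linear_combination ((τ+1)*τ'+1-τ)*hw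
        right; right; right; left
        refine ⟨?_, ?_, ?_⟩ <;> apply mul_left_cancel₀ hk
        · linear_combination (τ+1)^2*ea' - 2*ea - a*hkk + ((τ+1)*τ'+1-τ-2*(τ+1))*hw
        · linear_combination (τ+1)^2*ec' + 2*ec + c*hkk + ((τ+1)*τ'+1-τ+2*(τ+1))*hw
        · linear_combination (τ+1)^2*ed' - 2*ed - d*hkk + ((τ+1)*τ'+1-τ+α*(τ+1))*hw + (τ+1)^2*hβ' - 2*hβ
      · have hb : β = -3+α := by linear_combination h
        rw [hb] at hr e2
        right; right; right; right
        refine shift (8-2*α) (α^2) (-α^2+6*α-8) hA ?_ ?_ ?_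
        · linear_combination hr
        · linear_combination -e2 + hr
        · ring


/-- `E₀` consequence of the triple product being fixed -/
theorem zz_X1 (S : ZZS L σ) (v r0 r3 r4 : L) (hv : σ v = v) (n0 : r0 ≠ 0)
    (h0 : r0^2 = 1-2*v) (h3 : r3^2 = 1+v) (h4 : r4^2 = 1+2*v)
    (hf : σ (r0*r3*r4) = r0*r3*r4) : inQ v ∧ inQ (r3*r4/r0^3) := by
  have hs0 : σ (r0^2) = r0^2 := by rw [h0]; simp [map_ofNat, hv]
  have e : r3*r4/r0^3 = r0*r3*r4/(r0^2)^2 := by field_simp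
  have hs : σ (r3*r4/r0^3) = r3*r4/r0^3 := by
    rw [e, map_div₀, hf, map_pow σ (r0^2), hs0]
  have key := S.e0 (24*(v/r0^2)+9) (24*(r3*r4/r0^3)) (by
    rw [map_add, map_mul, map_div₀, hs0, hv]; simp [map_ofNat]) (by
    rw [map_mul, hs]; simp [map_ofNat]) (by
    have : (24*(r3*r4/r0^3))^2 = 576*(r3^2*r4^2)/(r0^2)^3 := by field_simp; ring
    rw [this, h3, h4]
    have n : r0^2 ≠ 0 := pow_ne_zero 2 n0
    obtain ⟨D, hD⟩ : ∃ D, D = r0^2 := ⟨_, rfl⟩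
    have hvD : v = (1-D)/2 := by rw [hD, h0]; ring
    rw [← hD] at n ⊢
    rw [hvD]
    field_simp
    ring)
  constructor
  · obtain ⟨q, hq⟩ := zz_inQ_lin (x := v/r0^2) 24 9 (by norm_num) (by simpa using key.1)
    have h5 : (q:L)*(1-2*v) = v := by rw [hq, ← h0]; field_simp
    have h6 : (1+2*q : ℚ) ≠ 0 := by
      intro h
      have : q = -1/2 := by linarith
      rw [this] at h5
      push_cast at h5
      have : (1:L) = 0 := by linear_combination -2*h5
      exact one_ne_zero this
    have h6' : (1+2*q : L) ≠ 0 := by exact_mod_cast h6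
    refine ⟨q/(1+2*q), ?_⟩
    push_cast
    rw [div_eq_iff h6']
    linear_combination h5
  · exact zz_inQ_lin (x := r3*r4/r0^3) 24 0 (by norm_num) (by simpa using key.2)

theorem zz_X2 (S : ZZS L σ) (v r0 r3 r4 : L) (hv2 : v = 2) (n0 : r0 ≠ 0)
    (h0 : r0^2 = 1-2*v) (h3 : r3^2 = 1+v) (h4 : r4^2 = 1+2*v)
    (hf : σ (r0*r3*r4) = r0*r3*r4) : False := by
  obtain ⟨q, hq⟩ := (zz_X1 S v r0 r3 r4 (by rw [hv2]; simp [map_ofNat]) n0 h0 h3 h4 hf).2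
  have h1 : (q:L)^2 * (-27) = 15 := by
    have : (r3*r4/r0^3)^2 * (r0^2)^3 = r3^2*r4^2 := by field_simp
    rw [← hq, h0, h3, h4, hv2] at this
    linear_combination this
  have h2 : q^2*(-27) = 15 := by exact_mod_cast h1
  nlinarith [sq_nonneg q]

theorem zz_Y (S : ZZS L σ) (v r0 r1 r3 r4 : L) (hv : σ v = v) (nv : v ≠ 0) (n0 : r0 ≠ 0)
    (n1 : r1 ≠ 0) (n3 : r3 ≠ 0) (n4 : r4 ≠ 0)
    (h0 : r0^2 = 1-2*v) (h1 : r1^2 = 1-v) (h3 : r3^2 = 1+v) (h4 : r4^2 = 1+2*v)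
    (hf : σ (r0*r1*r3*r4) = r0*r1*r3*r4) : 4*v^4-8*v^2+1 = 0 := by
  have key := S.n2 (1/v) (r0*r1*r3*r4/v^2) (by simp [hv]) (by rw [map_div₀, hf, map_pow, hv]) (by
    have : (r0*r1*r3*r4/v^2)^2 = r0^2*r1^2*r3^2*r4^2/v^4 := by field_simp
    rw [this, h0, h1, h3, h4]; field_simp; ring)
  have a1 : r1^2*r3^2 ≠ 0 := by positivity
  have a2 : r0^2*r4^2 ≠ 0 := by positivity
  rw [h1, h3] at a1
  rw [h0, h4] at a2
  rcases key with h | h | h | h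
  · exact absurd h (by simp [nv])
  · exfalso; apply a1
    field_simp at h
    linear_combination h
  · exfalso; apply a2
    field_simp at h
    linear_combination h
  · field_simp at h
    linear_combination h

theorem zz_V (S : ZZS L σ) (v r0 r3 r4 s : L) (hs : σ s = s) (hv : σ v = v) (nv : v ≠ 0)
    (n0 : r0 ≠ 0) (n4 : r4 ≠ 0)
    (h0 : r0^2 = 1-2*v) (h3 : r3^2 = 1+v) (h4 : r4^2 = 1+2*v)
    (hf : σ (r0*r4) = r0*r4) (hg : σ (r3*r4) = r3*r4) (hs3 : s^2 = 3) (hsv : v*(s+1) = 1) : False := by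
  have n1 : s+1 ≠ 0 := right_ne_zero_of_mul_eq_one hsv
  have hb : (r0*r4*(s+1))^2 = 2*s := by
    have : (r0*r4*(s+1))^2 = r0^2*r4^2*(s+1)^2 := by ring
    rw [this, h0, h4]
    linear_combination -4*(v*(s+1)+1)*hsv + hs3
  refine S.nv s (r0*r4*(s+1)) (2*(r3*r4)/(r0*r4*(1+s))) hs (by rw [map_mul, hf]; simp [hs])
    (by rw [map_div₀, map_mul σ 2, map_mul σ (r0*r4), hf, hg]; simp [hs, map_ofNat]) hs3 hb ?_
  have n2 : r0*r4*(1+s) ≠ 0 := mul_ne_zero (mul_ne_zero n0 n4) (by rwa [add_comm])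
  rw [div_pow, div_eq_iff (pow_ne_zero 2 n2)]
  have e1 : (2*(r3*r4))^2 = 4*(r3^2*r4^2) := by ring
  rw [e1, h3, h4]
  apply mul_left_cancel₀ (pow_ne_zero 2 n1)
  have e2 : (s+1)^2*((1+s)*(r0*r4*(1+s))^2) = (s+1)^3*(r0*r4*(s+1))^2 := by ring
  have e3 : (s+1)^2*(4*((1+v)*(1+2*v))) = 4*((s+1)+v*(s+1))*((s+1)+2*(v*(s+1))) := by ring
  rw [e2, e3, hb, hsv]
  linear_combination (4 - 2*(s^2+3)-6*s-6)*hs3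

theorem zz_q3L (S : ZZS L σ) (v : L) (hv : inQ v) (h : 4*v^4-8*v^2+1 = 0) : False := by
  obtain ⟨q, rfl⟩ := hv
  have : 4*q^4-8*q^2+1 = 0 := by exact_mod_cast h
  exact zz_q3 (2*q^2-2) (by linear_combination this)

theorem zz_main (S : ZZS L σ) (v r0 r1 r3 r4 : L) (nv : v ≠ 0) (n0 : r0 ≠ 0)
    (n1 : r1 ≠ 0) (n3 : r3 ≠ 0) (n4 : r4 ≠ 0)
    (h0 : r0^2 = 1-2*v) (h1 : r1^2 = 1-v) (h3 : r3^2 = 1+v) (h4 : r4^2 = 1+2*v) :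
    (σ r0 = r0 ∧ σ r4 = r4) ∧ (σ r1 = r1 ∨ σ r3 = r3) := by
  have F1 := zz_F S r1 r3 r4 v nv h1 h3 h4
  have F2 := zz_F S r3 r1 r0 (-v) (neg_ne_zero.mpr nv) (by rw [h3]; ring) (by rw [h1]; ring)
    (by rw [h0]; ring)
  have hv : σ v = v := by
    have hr : ∀ x : L, x^2 = 1 - v → (σ x = x ∨ σ x = -x) → σ v = v := by
      intro x hx h
      have h5 := congrArg σ hx
      rw [map_pow, map_sub, map_one] at h5
      rcases h with h | h <;> rw [h] at h5 <;> linear_combination h5 - hx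
    rcases F1 with h | h | h | h | h
    · exact hr r1 h1 (Or.inl h.1)
    · exact hr r1 h1 (Or.inr h.1)
    · exact hr r1 h1 (Or.inr h.1)
    · exact hr r1 h1 (Or.inl h.1)
    rcases F2 with h' | h' | h' | h' | h'
    · exact hr r1 h1 (Or.inl h'.2.1)
    · exact hr r1 h1 (Or.inr h'.2.1)
    · exact hr r1 h1 (Or.inl h'.2.1)
    · exact hr r1 h1 (Or.inr h'.2.1)
    rw [map_neg] at h'
    have h6 : v * σ v = 0 := by linear_combination (h+h')/2
    exact absurd h6 (mul_ne_zero nv ((map_ne_zero σ).mpr nv))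
  have s0 := zz_fix S (x := r0) (by rw [h0]; simp [map_ofNat, hv])
  have s1 := zz_fix S (x := r1) (by rw [h1]; simp [hv])
  have s3 := zz_fix S (x := r3) (by rw [h3]; simp [hv])
  have s4 := zz_fix S (x := r4) (by rw [h4]; simp [map_ofNat, hv])
  have neg_ne : ∀ x : L, x ≠ 0 → -x ≠ x := fun x hx h => hx (by
    have : 2*x = 0 := by linear_combination -h
    simpa using this)
  -- split F1, F2 into sign conditions or exceptional values
  have hm2 : v + σ v + v*σ v = 0 → v = -2 := by
    intro h
    rw [hv] at h
    have : v*(v+2) = 0 := by linear_combination h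
    rcases mul_eq_zero.mp this with h | h
    · exact absurd h nv
    · linear_combination h
  have hp2 : -v + σ (-v) + -v*σ (-v) = 0 → v = 2 := by
    intro h
    rw [map_neg, hv] at h
    have : v*(v-2) = 0 := by linear_combination h
    rcases mul_eq_zero.mp this with h | h
    · exact absurd h nv
    · linear_combination h
  have m0 := neg_ne r0 n0
  have m1 := neg_ne r1 n1
  have m3 := neg_ne r3 n3
  have m4 := neg_ne r4 n4
  have Y : v = 2 ∨ v = -2 → σ (r0*r1*r3*r4) = r0*r1*r3*r4 → False := by
    intro h hf
    have := zz_Y S v r0 r1 r3 r4 hv nv n0 n1 n3 n4 h0 h1 h3 h4 hf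
    rcases h with h | h <;> rw [h] at this <;> norm_num at this
  have X : v = 2 → σ (r0*r3*r4) = r0*r3*r4 → False := fun h hf =>
    zz_X2 S v r0 r3 r4 h n0 h0 h3 h4 hf
  have X' : v = -2 → σ (r4*r1*r0) = r4*r1*r0 → False := fun h hf =>
    zz_X2 S (-v) r4 r1 r0 (by rw [h]; ring) n4 (by rw [h4]; ring) (by rw [h1]; ring)
      (by rw [h0]; ring) hf
  have I : v = 2 → σ r1 = r1 → σ r3 = r3 → False := fun h a b =>
    S.i3 r1 r3 a b (by rw [h1, h]; ring) (by rw [h3, h]; ring)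
  have I' : v = -2 → σ r1 = r1 → σ r3 = r3 → False := fun h a b =>
    S.i3 r3 r1 b a (by rw [h3, h]; ring) (by rw [h1, h]; ring)
  rcases s1 with s1 | s1 <;> rcases s3 with s3 | s3
  · exfalso
    have b4 : σ r4 = -r4 := by
      rcases F1 with h | h | h | h | h
      · exact h.2.2
      · exact h.2.2
      · exact absurd (h.1.symm.trans s1) m1
      · exact absurd (h.2.1.symm.trans s3) m3
      · exact (I' (hm2 h) s1 s3).elim
    have b0 : σ r0 = -r0 := by
      rcases F2 with h | h | h | h | h
      · exact h.2.2
      · exact h.2.2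
      · exact absurd (h.1.symm.trans s3) m3
      · exact absurd (h.2.1.symm.trans s1) m1
      · exact (I (hp2 h) s1 s3).elim
    exact zz_q3L S v (zz_X1 S v r0 r3 r4 hv n0 h0 h3 h4 (by
      rw [map_mul, map_mul, b0, b4, s3]; ring)).1 (zz_Y S v r0 r1 r3 r4 hv nv n0 n1 n3 n4 h0 h1 h3 h4
        (by rw [map_mul, map_mul, map_mul, b0, b4, s3, s1]; ring))
  · have b4 : σ r4 = r4 ∨ v = -2 := by
      rcases F1 with h | h | h | h | h
      · exact absurd (s3.symm.trans h.2.1) m3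
      · exact absurd (h.1.symm.trans s1) m1
      · exact Or.inl h.2.2
      · exact Or.inl h.2.2
      · exact Or.inr (hm2 h)
    have b0 : σ r0 = r0 ∨ v = 2 := by
      rcases F2 with h | h | h | h | h
      · exact absurd (s3.symm.trans h.1) m3
      · exact absurd (h.2.1.symm.trans s1) m1
      · exact Or.inl h.2.2
      · exact Or.inl h.2.2
      · exact Or.inr (hp2 h)
    refine ⟨?_, Or.inl s1⟩
    rcases s0 with s0 | s0 <;> rcases s4 with s4 | s4
    · exact ⟨s0, s4⟩
    · exfalso
      rcases b4 with h | h
      · exact m4 (s4.symm.trans h)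
      · exact Y (Or.inr h) (by rw [map_mul, map_mul, map_mul, s0, s4, s3, s1]; ring)
    · exfalso
      rcases b0 with h | h
      · exact m0 (s0.symm.trans h)
      · exact X h (by rw [map_mul, map_mul, s0, s4, s3]; ring)
    · exfalso
      rcases b4 with h | h
      · exact m4 (s4.symm.trans h)
      rcases b0 with h' | h'
      · exact m0 (s0.symm.trans h')
      · rw [h] at h'; norm_num at h'
  · have b4 : σ r4 = r4 ∨ v = -2 := by
      rcases F1 with h | h | h | h | h
      · exact absurd (s1.symm.trans h.1) m1
      · exact absurd (h.2.1.symm.trans s3) m3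
      · exact Or.inl h.2.2
      · exact Or.inl h.2.2
      · exact Or.inr (hm2 h)
    have b0 : σ r0 = r0 ∨ v = 2 := by
      rcases F2 with h | h | h | h | h
      · exact absurd (s1.symm.trans h.2.1) m1
      · exact absurd (h.1.symm.trans s3) m3
      · exact Or.inl h.2.2
      · exact Or.inl h.2.2
      · exact Or.inr (hp2 h)
    refine ⟨?_, Or.inr s3⟩
    rcases s0 with s0 | s0 <;> rcases s4 with s4 | s4
    · exact ⟨s0, s4⟩
    · exfalso
      rcases b4 with h | h
      · exact m4 (s4.symm.trans h)
      · exact X' h (by rw [map_mul, map_mul, s0, s4, s1]; ring)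
    · exfalso
      rcases b0 with h | h
      · exact m0 (s0.symm.trans h)
      · exact Y (Or.inl h) (by rw [map_mul, map_mul, map_mul, s0, s4, s3, s1]; ring)
    · exfalso
      rcases b4 with h | h
      · exact m4 (s4.symm.trans h)
      rcases b0 with h' | h'
      · exact m0 (s0.symm.trans h')
      · rw [h] at h'; norm_num at h'
  · exfalso
    have b4 : σ r4 = -r4 ∨ v = -2 := by
      rcases F1 with h | h | h | h | h
      · exact Or.inl h.2.2
      · exact Or.inl h.2.2
      · exact absurd (s3.symm.trans h.2.1) m3
      · exact absurd (s1.symm.trans h.1) m1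
      · exact Or.inr (hm2 h)
    have b0 : σ r0 = -r0 ∨ v = 2 := by
      rcases F2 with h | h | h | h | h
      · exact Or.inl h.2.2
      · exact Or.inl h.2.2
      · exact absurd (s1.symm.trans h.2.1) m1
      · exact absurd (s3.symm.trans h.1) m3
      · exact Or.inr (hp2 h)
    rcases s0 with s0 | s0 <;> rcases s4 with s4 | s4
    · rcases b4 with h | h
      · exact m4 (h.symm.trans s4)
      rcases b0 with h' | h'
      · exact m0 (h'.symm.trans s0)
      · rw [h] at h'; norm_num at h'
    · rcases b0 with h | h
      · exact m0 (h.symm.trans s0)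
      · exact X h (by rw [map_mul, map_mul, s0, s4, s3]; ring)
    · rcases b4 with h | h
      · exact m4 (h.symm.trans s4)
      · exact X' h (by rw [map_mul, map_mul, s0, s4, s1]; ring)
    · have hY := zz_Y S v r0 r1 r3 r4 hv nv n0 n1 n3 n4 h0 h1 h3 h4
        (by rw [map_mul, map_mul, map_mul, s0, s4, s3, s1]; ring)
      obtain ⟨s, hs⟩ : ∃ s, 2*v*s = 1+2*v^2 := ⟨(1+2*v^2)/(2*v), by field_simp⟩
      have nv2 : 2*v ≠ 0 := mul_ne_zero two_ne_zero nv
      have hσs : σ s = s := by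
        apply mul_left_cancel₀ nv2
        have := congrArg σ hs
        simp [map_ofNat, hv] at this
        rw [this, hs]
      have hs3 : s^2 = 3 := by
        apply mul_left_cancel₀ (pow_ne_zero 2 nv2)
        linear_combination (2*v*s+1+2*v^2)*hs + hY
      have : (v*(s+1)-1)*(v*(s-1)-1) = 0 := by linear_combination v^2*hs3 - hs
      rcases mul_eq_zero.mp this with h | h
      · exact zz_V S v r0 r3 r4 s hσs hv nv n0 n4 h0 h3 h4 (by rw [map_mul, s0, s4]; ring)
          (by rw [map_mul, s3, s4]; ring) hs3 (by linear_combination h)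
      · exact zz_V S (-v) r4 r1 r0 (-s) (by rw [map_neg, hσs]) (by rw [map_neg, hv])
          (neg_ne_zero.mpr nv) n4 n0 (by rw [h4]; ring) (by rw [h1]; ring) (by rw [h0]; ring)
          (by rw [map_mul, s0, s4]; ring)
          (by rw [map_mul, s1, s0]; ring) (by rw [← hs3]; ring) (by linear_combination h)

theorem zz_end (S : ZZS L σ) (t X : L) (ht : σ t = t) (hX : σ X = X)
    (h : X ^ 2 = t ^ 4 - 2 * t ^ 3 + 2 * t ^ 2 + 2 * t + 1) : inQ t ∧ inQ X := by
  obtain ⟨z, hz⟩ : ∃ z, z = X - t^2 + t := ⟨_, rfl⟩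
  obtain ⟨w, hw⟩ : ∃ w, w = (1-2*z)*t+(1+z) := ⟨_, rfl⟩
  have hσz : σ z = z := by rw [hz]; simp [ht, hX]
  have hσw : σ w = w := by rw [hw]; simp [ht, hσz, map_ofNat]
  have e : z^2 + 2*z*t^2 - 2*z*t - t^2 - 2*t - 1 = 0 := by rw [hz]; linear_combination h
  have key := S.e0 (1-2*z) (2*w) (by simp [hσz, map_ofNat]) (by simp [hσw, map_ofNat])
    (by rw [hw]; linear_combination (-4*(1-2*z))*e)
  obtain ⟨z, rfl⟩ := zz_inQ_lin (x := z) (-2) 1 (by norm_num) (by convert key.1 using 1; push_cast; ring)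
  obtain ⟨w, rfl⟩ := zz_inQ_lin (x := w) 2 0 (by norm_num) (by simpa using key.2)
  have htq : inQ t := by
    by_cases h2 : z = 1/2
    · refine ⟨-1/4, ?_⟩
      rw [h2] at e
      push_cast at e ⊢
      linear_combination e/3
    · have h3 : (1-2*z) ≠ 0 := fun h => h2 (by linarith)
      have h3' : (1-2*z : L) ≠ 0 := by exact_mod_cast h3
      refine ⟨(w-1-z)/(1-2*z), ?_⟩
      push_cast
      rw [div_eq_iff h3']
      linear_combination hw
  refine ⟨htq, ?_⟩
  obtain ⟨t, rfl⟩ := htq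
  exact ⟨z+t^2-t, by push_cast; linear_combination hz⟩

theorem zz_final (S : ZZS L σ) (t X₁ X₃ : L) (hpt : CPt t X₁ X₃) (hnt : CNontrivial t X₁ X₃) :
    inQ t ∧ (inQ X₁ ∨ inQ X₃) := by
  obtain ⟨p1, p3⟩ := hpt
  obtain ⟨t0, t1, t2, x1, x3, x2, x0, x4⟩ := hnt
  have nv : 2*t*(t^2-1)/(t^2+1)^2 ≠ 0 := by
    have : t^2-1 ≠ 0 := by
      intro h
      have : (t-1)*(t+1) = 0 := by linear_combination h
      rcases mul_eq_zero.mp this with h | h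
      · exact t1 (by linear_combination h)
      · exact t2 (by linear_combination h)
    exact div_ne_zero (mul_ne_zero (mul_ne_zero two_ne_zero t0) this) (pow_ne_zero 2 x2)
  obtain ⟨⟨s0, s4⟩, h⟩ := zz_main S _ ((t^2-2*t-1)/(t^2+1)) (X₁/(t^2+1)) (X₃/(t^2+1))
    ((t^2+2*t-1)/(t^2+1)) nv (div_ne_zero x0 x2) (div_ne_zero x1 x2) (div_ne_zero x3 x2)
    (div_ne_zero x4 x2) (by field_simp; ring) (by rw [div_pow, p1]; field_simp; ring)
    (by rw [div_pow, p3]; field_simp; ring) (by field_simp; ring)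
  have hr : σ (2/(t^2+1)) = 2/(t^2+1) := by
    have e : 2/(t^2+1) = 1 - ((t^2-2*t-1)/(t^2+1) + (t^2+2*t-1)/(t^2+1))/2 := by field_simp; ring
    rw [e, map_sub, map_div₀ σ _ 2, map_add, s0, s4]; simp [map_ofNat]
  have ht : σ t = t := by
    have e : t = ((t^2+2*t-1)/(t^2+1) - (t^2-2*t-1)/(t^2+1))/(2*(2/(t^2+1))) := by field_simp; ring
    have e2 := congrArg σ e
    rw [map_div₀, map_sub, s0, s4, map_mul, hr] at e2
    rw [e2]
    conv_rhs => rw [e]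
    simp [map_ofNat]
  have ht2 : σ (t^2+1) = t^2+1 := by simp [ht]
  rcases h with h | h
  · rw [map_div₀, ht2] at h
    have := zz_end S t X₁ ht (by field_simp at h; exact h) p1
    exact ⟨this.1, Or.inl this.2⟩
  · rw [map_div₀, ht2] at h
    have := zz_end S (-t) X₃ (by rw [map_neg, ht]) (by field_simp at h; exact h) (by rw [p3]; ring)
    obtain ⟨⟨q, hq⟩, h3⟩ := this
    exact ⟨⟨-q, by push_cast; rw [hq]; ring⟩, Or.inr h3⟩
end zzgeom

theorem quadratic_points_on_C_of_E0_rational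
    (K L : Type*) [Field K] [NumberField K] [Field L] [NumberField L] [Algebra K L]
    (hquad : Module.finrank K L = 2)
    (hKcyc : ¬ IsCyclotomicExtension {12} ℚ K)
    (hcond : condA K ∨ condB K)
    (hE0 : ∀ x y : K, y ^ 2 = x ^ 3 - x ^ 2 - 9 * x + 9 → inQ x ∧ inQ y)
    (t X₁ X₃ : L) (hpt : CPt t X₁ X₃) (hnt : CNontrivial t X₁ X₃) :
    inQ t ∧ (inQ X₁ ∨ inQ X₃) := by
  have hx : ZZEx K := zz_Ex hE0
  obtain ⟨N1, N2, NV⟩ := hcond.elim zz_NA (zz_NB hx)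
  have : Algebra.IsQuadraticExtension K L := { finrank_eq_two' := hquad }
  have hG : IsGalois K L := inferInstance
  have hfd : FiniteDimensional K L := Module.finite_of_finrank_eq_succ hquad
  have hcard : Nat.card Gal(L/K) = 2 := by rw [IsGalois.card_aut_eq_finrank, hquad]
  obtain ⟨g, hg⟩ : ∃ g : Gal(L/K), g ≠ 1 := by
    have : Nontrivial Gal(L/K) := Finite.one_lt_card_iff_nontrivial.mp (by rw [hcard]; norm_num)
    exact exists_ne 1
  have hg2 : g * g = 1 := by
    have := pow_card_eq_one' (x := g)
    rwa [hcard, sq] at this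
  have hall : ∀ f : Gal(L/K), f = 1 ∨ f = g := by
    intro f
    by_contra hc
    push Not at hc
    have hinj : Function.Injective ![1, g, f] := by
      intro i j hij
      fin_cases i <;> fin_cases j <;> simp_all
    have := Nat.card_le_card_of_injective _ hinj
    rw [hcard] at this
    simp at this
  have hfix : ∀ x : L, g x = x → ∃ k : K, algebraMap K L k = x := by
    intro x hxg
    have := (IsGalois.mem_bot_iff_fixed (F := K) (E := L) x).mpr (by
      intro f
      rcases hall f with h | h
      · rw [h]; rfl
      · rw [h]; exact hxg)
    exact IntermediateField.mem_bot.mp this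
  have hi : Function.Injective (algebraMap K L) := (algebraMap K L).injective
  have hQ : ∀ k : K, inQ k → inQ (algebraMap K L k) := by
    rintro k ⟨q, rfl⟩
    exact ⟨q, by simp⟩
  have S : ZZS L (g : L →+* L) := by
    refine ⟨?_, ?_, ?_, ?_, ?_, ?_⟩
    · intro x
      exact congrArg (fun f : Gal(L/K) => f x) hg2
    · intro ρ W h1 h2 h
      obtain ⟨ρ, rfl⟩ := hfix ρ h1
      obtain ⟨W, rfl⟩ := hfix W h2
      rcases N1 ρ W (hi (by simpa using h)) with h | h | h <;> rw [h] <;> simp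
    · intro c y h1 h2 h
      obtain ⟨c, rfl⟩ := hfix c h1
      obtain ⟨y, rfl⟩ := hfix y h2
      rcases N2 c y (hi (by simpa [map_ofNat] using h)) with h | h | h | h
      · left; rw [h]; simp
      · right; left; rw [← map_pow, h]; simp
      · right; right; left; rw [← map_pow, h]; simp [map_ofNat]
      · right; right; right
        have := congrArg (algebraMap K L) h
        simpa [map_ofNat] using this
    · intro s b h h1 h2 h3 e1 e2 e3
      obtain ⟨s, rfl⟩ := hfix s h1
      obtain ⟨b, rfl⟩ := hfix b h2
      obtain ⟨h, rfl⟩ := hfix h h3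
      exact NV s b h (hi (by simpa [map_ofNat] using e1)) (hi (by simpa [map_ofNat] using e2))
        (hi (by simpa [map_ofNat] using e3))
    · intro x y h1 h2 h
      obtain ⟨x, rfl⟩ := hfix x h1
      obtain ⟨y, rfl⟩ := hfix y h2
      have := hE0 x y (hi (by simpa [map_ofNat] using h))
      exact ⟨hQ _ this.1, hQ _ this.2⟩
    · intro i s h1 h2 e1 e2
      obtain ⟨i, rfl⟩ := hfix i h1
      obtain ⟨s, rfl⟩ := hfix s h2
      exact hx.i3 i s (hi (by simpa [map_ofNat] using e1)) (hi (by simpa [map_ofNat] using e2))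
  exact zz_final S t X₁ X₃ hpt hnt
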